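/- Let F = ∗_{α∈I} G_α be the free product of nontrivial groups G_α, α ∈ I, and let H1 be a finitely generated factor-free noncyclic subgroup of F. Then there exist two disjoint finite subsets I1, I2 of I and a finitely generated noncyclic subgroup Ĥ1 of F̂ := Ĝ1 ∗ Ĝ2 (where Ĝ1 := ∗_{α∈I1} G_α, Ĝ2 := ∗_{α∈I2} G_α), factor-free with respect to the two factors Ĝ1 and Ĝ2, with r̄(Ĥ1) = r̄(H1) and with the property: if every group G_α with α ∈ I1 ∪ I2 is finite, then, setting d_M := max { |I1 ∪ I2|, max{ |G_α| : α ∈ I1 ∪ I2 } }, one has σ_{d_M}(Ĥ1) ≥ σ(H1), where σ_{d_M}(Ĥ1) is the WN_{d_M}-coefficient of Ĥ1 in F̂ and σ(H1) is the WN-coefficient of H1 in F. -/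

import Mathlib

open Monoid

section Defs

variable {F : Type} [Group F]

def conjS (t : F) (K : Subgroup F) : Subgroup F := K.map (MulAut.conj t).toMonoidHom

noncomputable def rk (H : Subgroup F) : ℕ :=
  sInf {n : ℕ | ∃ S : Finset F, S.card = n ∧ Subgroup.closure (S : Set F) = H}

noncomputable def rrk (H : Subgroup F) : ℕ := rk H - 1

def dcSetoid (H K : Subgroup F) : Setoid F where
  r s t := ∃ h ∈ H, ∃ k ∈ K, h * s * k = t
  iseqv := by
    refine ⟨fun s => ⟨1, H.one_mem, 1, K.one_mem, by group⟩, ?_, ?_⟩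
    · rintro s t ⟨h, hh, k, hk, rfl⟩
      exact ⟨h⁻¹, H.inv_mem hh, k⁻¹, K.inv_mem hk, by group⟩
    · rintro s t u ⟨h, hh, k, hk, rfl⟩ ⟨h', hh', k', hk', rfl⟩
      exact ⟨h' * h, H.mul_mem hh' hh, k * k', K.mul_mem hk hk', by group⟩

noncomputable def rrkInter (H K : Subgroup F) : ℕ :=
  finsum fun q : Quotient (dcSetoid H K) => rrk (H ⊓ conjS q.out K)

def Noncyclic (H : Subgroup F) : Prop := ∀ g : F, H ≠ Subgroup.closure {g}

end Defs

section Graphs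

/-- A labeled `A`-graph over the alphabet `A = ⊔_{i} G i`: a bipartite graph with
primary and secondary vertices, oriented edges with a fixed-point-free involution
`bar`, a type function on (secondary) vertices and an edge labeling. -/
structure AGraph (ι : Type) (G : ι → Type) [∀ i, Group (G i)] : Type 1 where
  /-- vertices -/
  V : Type
  /-- oriented edges -/
  E : Type
  /-- `prim v` holds iff `v` is a primary vertex; otherwise `v` is secondary -/
  prim : V → Prop
  /-- the edge with the opposite orientation -/
  bar : E → E
  bar_bar : ∀ e, bar (bar e) = e
  bar_ne : ∀ e, bar e ≠ e
  /-- initial vertex -/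
  ini : E → V
  /-- terminal vertex -/
  ter : E → V
  ini_bar : ∀ e, ini (bar e) = ter e
  /-- every edge connects a primary and a secondary vertex -/
  bipartite : ∀ e, prim (ini e) ↔ ¬ prim (ter e)
  /-- the type of a (secondary) vertex -/
  typ : V → ι
  /-- the label of an edge, an element of `A = ⊔_i G i` -/
  lab : E → Σ i, G i
  lab_bar : ∀ e, lab (bar e) = ⟨(lab e).1, (lab e).2⁻¹⟩
  /-- the label of an edge ending in a secondary vertex of type `i` lies in `G i` -/
  lab_typ : ∀ e, ¬ prim (ter e) → (lab e).1 = typ (ter e)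

namespace AGraph

variable {ι : Type} {G : ι → Type} [∀ i, Group (G i)] (Ψ : AGraph ι G)

/-- The degree of a vertex: the number of oriented edges ending at it. -/
noncomputable def deg (v : Ψ.V) : ℕ := Set.ncard {e : Ψ.E | Ψ.ter e = v}

/-- `Ψ` is a finite graph. -/
def FiniteGraph : Prop := Finite Ψ.V ∧ Finite Ψ.E

/-- `Ψ` is a connected graph. -/
def Connected : Prop :=
  ∀ u v : Ψ.V,
    Relation.ReflTransGen (fun a b => ∃ e : Ψ.E, Ψ.ini e = a ∧ Ψ.ter e = b) u v

/-- Properties (P1)-(P3) of an irreducible `A`-graph. -/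
def Irr : Prop :=
  (∀ e f : Ψ.E, Ψ.ini e = Ψ.ini f → Ψ.prim (Ψ.ini e) → Ψ.ter e ≠ Ψ.ter f →
      Ψ.typ (Ψ.ter e) ≠ Ψ.typ (Ψ.ter f)) ∧
  (∀ e f : Ψ.E, e ≠ f → Ψ.ter e = Ψ.ter f → ¬ Ψ.prim (Ψ.ter e) → Ψ.lab e ≠ Ψ.lab f) ∧
  (∀ e f : Ψ.E, Ψ.ini e = Ψ.ini f → Ψ.ter e = Ψ.ter f → e = f) ∧
  (∀ v : Ψ.V, 0 < Ψ.deg v) ∧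
  (∀ v w : Ψ.V, Ψ.deg v = 1 → Ψ.deg w = 1 → v = w) ∧
  (∀ v : Ψ.V, Ψ.deg v = 1 → Ψ.prim v)

/-- A path in `Ψ`: a list of consecutive edges. -/
def IsPath (p : List Ψ.E) : Prop := p.Chain' fun e f => Ψ.ter e = Ψ.ini f

/-- A reduced path: a path with no subpath `e e⁻¹`. -/
def IsRedPath (p : List Ψ.E) : Prop :=
  p.Chain' fun e f => Ψ.ter e = Ψ.ini f ∧ f ≠ Ψ.bar e

/-- The path `p` is closed at `v` (a path of length `0` is closed at every vertex). -/
def ClosedAt (p : List Ψ.E) (v : Ψ.V) : Prop :=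
  (∀ e ∈ p.head?, Ψ.ini e = v) ∧ (∀ e ∈ p.getLast?, Ψ.ter e = v)

/-- The label of a path: the product of the labels of its edges, in `∗_i G i`. -/
def pathLabel (p : List Ψ.E) : CoprodI G :=
  (p.map fun e => CoprodI.of (Ψ.lab e).2).prod

/-- A cyclically reduced closed path: a nonempty reduced closed path whose cyclic
shift by one edge is also reduced. -/
def IsCycRed (p : List Ψ.E) : Prop :=
  p ≠ [] ∧ Ψ.IsRedPath p ∧
    ∀ e ∈ p.head?, ∀ f ∈ p.getLast?, Ψ.ter f = Ψ.ini e ∧ e ≠ Ψ.bar f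

/-- The edges of the core of `Ψ`: the edges lying on a cyclically reduced closed path
(up to orientation). -/
def coreES : Set Ψ.E := {e | ∃ p, Ψ.IsCycRed p ∧ (e ∈ p ∨ Ψ.bar e ∈ p)}

/-- The vertices of the core of `Ψ`. -/
def coreVS : Set Ψ.V := {v | ∃ e ∈ Ψ.coreES, Ψ.ini e = v ∨ Ψ.ter e = v}

/-- The core of `Ψ`: the minimal subgraph of `Ψ` containing every edge that lies on
a cyclically reduced closed path in `Ψ`. -/
def core : AGraph ι G where
  V := {v : Ψ.V // v ∈ Ψ.coreVS}
  E := {e : Ψ.E // e ∈ Ψ.coreES}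
  prim v := Ψ.prim v.1
  bar e := ⟨Ψ.bar e.1, by
    obtain ⟨p, hp, he⟩ := e.2
    refine ⟨p, hp, ?_⟩
    rcases he with h | h
    · exact Or.inr (by rwa [Ψ.bar_bar])
    · exact Or.inl h⟩
  bar_bar e := Subtype.ext (Ψ.bar_bar e.1)
  bar_ne e h := Ψ.bar_ne e.1 (congrArg Subtype.val h)
  ini e := ⟨Ψ.ini e.1, ⟨e.1, e.2, Or.inl rfl⟩⟩
  ter e := ⟨Ψ.ter e.1, ⟨e.1, e.2, Or.inr rfl⟩⟩
  ini_bar e := Subtype.ext (Ψ.ini_bar e.1)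
  bipartite e := Ψ.bipartite e.1
  typ v := Ψ.typ v.1
  lab e := Ψ.lab e.1
  lab_bar e := Ψ.lab_bar e.1
  lab_typ e := Ψ.lab_typ e.1

end AGraph

variable {ι : Type} {G : ι → Type} [∀ i, Group (G i)]

/-- A subgroup of the free product `∗_i G i` is factor-free if it meets every conjugate
of every factor trivially. -/
def FactorFreeI (H : Subgroup (CoprodI G)) : Prop :=
  ∀ (s : CoprodI G) (i : ι),
    H ⊓ conjS s (CoprodI.of : G i →* CoprodI G).range = ⊥

/-- `Ψ` with base vertex `o` is an irreducible graph of the subgroup `H`: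
`Ψ` is a finite connected irreducible `A`-graph, `o` is primary (and is the vertex of
degree `1` if one exists), and a reduced word `W` lies in `H` iff it is the label of a
reduced path `p` closed at `o` with `|p| = 2|W|`. -/
def IsIrrGraphOf (Ψ : AGraph ι G) (o : Ψ.V) (H : Subgroup (CoprodI G)) : Prop :=
  Ψ.FiniteGraph ∧ Ψ.Connected ∧ Ψ.Irr ∧ Ψ.prim o ∧ (∀ v, Ψ.deg v = 1 → v = o) ∧
    ∀ w : CoprodI.Word G,
      (w.prod ∈ H ↔ ∃ p : List Ψ.E, Ψ.IsRedPath p ∧ Ψ.ClosedAt p o ∧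
        Ψ.pathLabel p = w.prod ∧ p.length = 2 * w.toList.length)

/-- `Ψ` is an irreducible core graph of `H`: the core of an irreducible graph of `H`. -/
def IsIrrCoreGraphOf (Ψ : AGraph ι G) (H : Subgroup (CoprodI G)) : Prop :=
  ∃ (Ψ₀ : AGraph ι G) (o : Ψ₀.V), IsIrrGraphOf Ψ₀ o H ∧ Ψ = Ψ₀.core

end Graphs

/-- The two-element family of groups `b ↦ (if b then G1 else G2)`, so that
`CoprodI (famTwo G1 G2)` is the free product `G1 ∗ G2`. -/
def famTwo (G1 G2 : Type) : Bool → Type := fun b => cond b G1 G2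

instance famTwoGroup (G1 G2 : Type) [Group G1] [Group G2] (b : Bool) :
    Group (famTwo G1 G2 b) :=
  match b with
  | true => inferInstanceAs (Group G1)
  | false => inferInstanceAs (Group G2)

section WN

variable {ι : Type} {G : ι → Type} [∀ i, Group (G i)]

/-- The set of ratios `r̄(H1, H2)/(r̄(H1)·r̄(H2))` over all finitely generated factor-free
noncyclic subgroups `H2`; its supremum is the WN-coefficient `σ(H1)`. -/
noncomputable def wnSetI (H1 : Subgroup (Monoid.CoprodI G)) : Set ℝ :=
  {x | ∃ H2 : Subgroup (Monoid.CoprodI G), H2.FG ∧ FactorFreeI H2 ∧ Noncyclic H2 ∧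
    x = (rrkInter H1 H2 : ℝ) / ((rrk H1 : ℝ) * (rrk H2 : ℝ))}

/-- Membership in `K_ff(F, d)`: `H` is a finitely generated factor-free noncyclic
subgroup admitting an irreducible core graph all of whose vertices have degree `≤ d`. -/
def memKff (H : Subgroup (Monoid.CoprodI G)) (d : ℕ) : Prop :=
  H.FG ∧ FactorFreeI H ∧ Noncyclic H ∧
    ∃ Ψ : AGraph ι G, IsIrrCoreGraphOf Ψ H ∧ ∀ v, Ψ.deg v ≤ d

/-- The set of ratios `r̄(H1, H2)/(r̄(H1)·r̄(H2))` over all `H2 ∈ K_ff(F, d)`;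
its supremum is the WN_d-coefficient `σ_d(H1)`. -/
noncomputable def wnSetD (H1 : Subgroup (Monoid.CoprodI G)) (d : ℕ) : Set ℝ :=
  {x | ∃ H2 : Subgroup (Monoid.CoprodI G), memKff H2 d ∧
    x = (rrkInter H1 H2 : ℝ) / ((rrk H1 : ℝ) * (rrk H2 : ℝ))}

end WN

section FreeAction

variable {ι : Type} {G : ι → Type} [∀ i, Group (G i)] {X : Type} [MulAction (CoprodI G) X]

/-- The orbit relation on `X` of the `i`-th factor of a free product. -/
def factorSetoid (X : Type) [MulAction (CoprodI G) X] (i : ι) : Setoid X where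
  r x y := ∃ g : G i, (CoprodI.of g : CoprodI G) • y = x
  iseqv := by
    refine ⟨fun x => ⟨1, by simp⟩, ?_, ?_⟩
    · rintro x y ⟨g, rfl⟩
      exact ⟨g⁻¹, by simp⟩
    · rintro x y z ⟨g, rfl⟩ ⟨h, rfl⟩
      exact ⟨g * h, by simp [mul_smul]⟩

/-- A chosen representative of the orbit of `x` under the `i`-th factor. -/
noncomputable def orbitRep (i : ι) (x : X) : X :=
  (Quotient.mk (factorSetoid (G := G) X i) x).out

theorem exists_smul_orbitRep (i : ι) (x : X) :
    ∃ g : G i, (CoprodI.of g : CoprodI G) • orbitRep (G := G) i x = x :=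
  (factorSetoid (G := G) X i).symm (Quotient.mk_out (s := factorSetoid (G := G) X i) x)

/-- The element of the `i`-th factor moving the representative of the orbit of `x` to `x`. -/
noncomputable def orbitCoord (i : ι) (x : X) : G i := (exists_smul_orbitRep (G := G) i x).choose

theorem orbitCoord_smul (i : ι) (x : X) :
    (CoprodI.of (orbitCoord (G := G) i x) : CoprodI G) • orbitRep (G := G) i x = x :=
  (exists_smul_orbitRep (G := G) i x).choose_spec

theorem orbitRep_smul (i : ι) (g : G i) (x : X) :
    orbitRep (G := G) i ((CoprodI.of g : CoprodI G) • x) = orbitRep (G := G) i x := by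
  unfold orbitRep
  congr 1
  exact Quotient.sound ⟨g, rfl⟩

/-- Every factor of the free product acts freely on `X`. -/
def FactorsActFreely (G : ι → Type) [∀ i, Group (G i)] (X : Type)
    [MulAction (CoprodI G) X] : Prop :=
  ∀ (i : ι) (g : G i) (x : X), (CoprodI.of g : CoprodI G) • x = x → g = 1

theorem FactorsActFreely.eq_of_smul_eq (hX : FactorsActFreely G X) {i : ι} {g h : G i} {x : X}
    (e : (CoprodI.of g : CoprodI G) • x = (CoprodI.of h : CoprodI G) • x) : g = h := by
  have : h⁻¹ * g = 1 := hX i _ x (by rw [map_mul, mul_smul, e, ← mul_smul, ← map_mul]; simp)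
  exact (inv_mul_eq_one.1 this).symm

theorem FactorsActFreely.orbitCoord_of_smul (hX : FactorsActFreely G X) (i : ι) (g : G i) (x : X) :
    orbitCoord (G := G) i ((CoprodI.of g : CoprodI G) • x) = g * orbitCoord (G := G) i x := by
  apply hX.eq_of_smul_eq (x := orbitRep (G := G) i x)
  rw [map_mul, mul_smul, orbitCoord_smul, ← orbitRep_smul i g x, orbitCoord_smul]

open CategoryTheory ActionCategory SemidirectProduct

open scoped Classical in
/-- The action groupoid of a free product whose factors act freely is free. -/
@[reducible]
noncomputable def FactorsActFreely.isFreeGroupoid (hX : FactorsActFreely G X) :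
    IsFreeGroupoid (ActionCategory (CoprodI G) X) where
  quiverGenerators :=
    ⟨fun a b => {i : ι // orbitRep (G := G) i b.back = a.back ∧ b.back ≠ a.back}⟩
  of := fun {a b} e => ⟨CoprodI.of (orbitCoord e.1 b.back), by
    have := orbitCoord_smul (G := G) e.1 b.back
    rwa [e.2.1] at this⟩
  unique_lift := by
    intro B _ f
    let lam : ι → X → B := fun i b =>
      if h : b ≠ orbitRep (G := G) i b then
        @f ⟨(), orbitRep (G := G) (X := X) i b⟩ ⟨(), b⟩ ⟨i, rfl, h⟩ else 1
    let Fi : ∀ i, G i →* (X → B) ⋊[mulAutArrow] (CoprodI G) := fun i =>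
      { toFun := fun g => ⟨fun b => lam i b * (lam i ((CoprodI.of g : CoprodI G)⁻¹ • b))⁻¹,
          CoprodI.of g⟩
        map_one' := by
          ext b
          · simp
          · simp
        map_mul' := by
          intro g h
          ext b
          · simp only [SemidirectProduct.mul_left, map_mul, mul_inv_rev, mul_smul]
            change _ = lam i b * (lam i ((CoprodI.of g : CoprodI G)⁻¹ • b))⁻¹ *
              (lam i ((CoprodI.of g : CoprodI G)⁻¹ • b) *
                (lam i ((CoprodI.of h : CoprodI G)⁻¹ • (CoprodI.of g : CoprodI G)⁻¹ • b))⁻¹)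
            group
          · simp }
    let F' : CoprodI G →* (X → B) ⋊[mulAutArrow] (CoprodI G) := CoprodI.lift Fi
    have hF' : ∀ i (g : G i), F' (CoprodI.of g) = Fi i g := fun i g => by simp [F']
    refine ⟨uncurry F' ?_, ?_, ?_⟩
    · suffices SemidirectProduct.rightHom.comp F' = MonoidHom.id _ by
        exact DFunLike.ext_iff.mp this
      apply CoprodI.ext_hom
      intro i
      ext g
      simp [hF', Fi]
    · rintro ⟨⟨⟩, a : X⟩ ⟨⟨⟩, b : X⟩ ⟨i, h1 : orbitRep i b = a, h2 : b ≠ a⟩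
      subst h1
      change (F' (CoprodI.of (orbitCoord i b))).left b = _
      rw [hF']
      have e1 : (CoprodI.of (orbitCoord (G := G) i b) : CoprodI G)⁻¹ • b = orbitRep (G := G) i b := by
        rw [inv_smul_eq_iff, orbitCoord_smul]
      have e2 : orbitRep (G := G) i (orbitRep (G := G) i b) = orbitRep (G := G) i b := by
        conv_rhs => rw [← orbitCoord_smul (G := G) i b]
        rw [orbitRep_smul]
      have l1 : lam i (orbitRep (G := G) i b) = 1 := by simp [lam, e2]
      have l2 : lam i b = @f ⟨(), orbitRep (G := G) (X := X) i b⟩ ⟨(), b⟩ ⟨i, rfl, h2⟩ := by simp [lam, h2]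
      change lam i b * (lam i _)⁻¹ = _
      rw [e1, l1, l2]
      simp
    · intro E hE
      let ev (a b : X) (u : CoprodI G) (h : u • a = b) : B :=
        E.map (⟨u, h⟩ : @Quiver.Hom (ActionCategory (CoprodI G) X) _ ⟨(), a⟩ ⟨(), b⟩)
      have ev_comp : ∀ (a b c : X) (u v : CoprodI G) (h : u • a = b) (h' : v • b = c),
          ev a c (v * u) (by rw [mul_smul, h, h']) = ev b c v h' * ev a b u h := by
        intro a b c u v h h'
        exact E.map_comp (⟨u, h⟩ : @Quiver.Hom (ActionCategory (CoprodI G) X) _ ⟨(), a⟩ ⟨(), b⟩)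
          (⟨v, h'⟩ : @Quiver.Hom (ActionCategory (CoprodI G) X) _ ⟨(), b⟩ ⟨(), c⟩)
      have ev_one : ∀ (a : X) (u : CoprodI G) (h : u • a = a), u = 1 → ev a a u h = 1 := by
        rintro a u h rfl
        exact E.map_id _
      have ev_lam : ∀ (i : ι) (b : X),
          ev (orbitRep (G := G) i b) b _ (orbitCoord_smul i b) = lam i b := by
        intro i b
        by_cases hb : b = orbitRep (G := G) i b
        · have key : ∀ (r : X) (c : G i) (h : (CoprodI.of c : CoprodI G) • r = b), b = r →
              ev r b _ h = 1 := by
            rintro r c h rfl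
            exact ev_one b _ h (by rw [hX i c b h, map_one])
          rw [key _ _ _ hb]
          simp [lam, ← hb]
        · simp only [lam, ne_eq, hb, not_false_eq_true, dite_true]
          exact hE ⟨(), orbitRep (G := G) (X := X) i b⟩ ⟨(), b⟩ ⟨i, rfl, hb⟩
      have : curry E = F' := by
        apply CoprodI.ext_hom
        intro i
        ext g b
        · change ev ((CoprodI.of g : CoprodI G)⁻¹ • b) b (CoprodI.of g) (smul_inv_smul _ _) =
            (F' (CoprodI.of g)).left b
          rw [hF']
          change _ = lam i b * (lam i ((CoprodI.of g : CoprodI G)⁻¹ • b))⁻¹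
          rw [eq_mul_inv_iff_mul_eq]
          have h3 : orbitRep (G := G) i ((CoprodI.of g : CoprodI G)⁻¹ • b) =
              orbitRep (G := G) i b := by
            rw [← map_inv, orbitRep_smul]
          have h4 : orbitCoord (G := G) i b =
              g * orbitCoord (G := G) i ((CoprodI.of g : CoprodI G)⁻¹ • b) := by
            rw [← hX.orbitCoord_of_smul, smul_inv_smul]
          rw [← ev_lam, ← ev_lam, ← ev_comp]
          congr 1
          rw [h4, map_mul]
        · exact (congrArg (fun y => y.right) (hF' i g)).symm
      apply Functor.hext
      · intro
        apply Unit.ext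
      · refine ActionCategory.cases ?_
        intro t g
        exact heq_of_eq (congrArg (fun φ => (φ g).left t) this)

end FreeAction

section FactorFree

variable {ι : Type} {G : ι → Type} [∀ i, Group (G i)]

theorem mem_conjS {F : Type} [Group F] {t x : F} {K : Subgroup F} :
    x ∈ conjS t K ↔ t⁻¹ * x * t ∈ K := by
  unfold conjS
  rw [Subgroup.mem_map]
  constructor
  · rintro ⟨y, hy, rfl⟩
    simpa [mul_assoc] using hy
  · intro h
    exact ⟨_, h, by simp [mul_assoc]⟩

theorem factorFreeI_iff {H : Subgroup (CoprodI G)} :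
    FactorFreeI H ↔ ∀ (s : CoprodI G) (i : ι) (g : G i), s⁻¹ * CoprodI.of g * s ∈ H → g = 1 := by
  constructor
  · intro h s i g hg
    have : s⁻¹ * CoprodI.of g * s ∈ H ⊓ conjS s⁻¹ (CoprodI.of : G i →* CoprodI G).range := by
      refine ⟨hg, mem_conjS.2 ⟨g, by group⟩⟩
    rw [h s⁻¹ i, Subgroup.mem_bot] at this
    have h2 : (CoprodI.of g : CoprodI G) = 1 := by
      have := congrArg (fun x => s * x * s⁻¹) this
      simpa [mul_assoc] using this
    exact CoprodI.of_injective i (by rw [h2, map_one])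
  · intro h s i
    rw [eq_bot_iff]
    rintro x ⟨hx, hx2⟩
    obtain ⟨g, hg⟩ := mem_conjS.1 hx2
    have hx' : x = s * CoprodI.of g * s⁻¹ := by rw [hg]; group
    have := h s⁻¹ i g (by rw [inv_inv, ← hx']; exact hx)
    rw [hx', this]
    simp

theorem FactorFreeI.factorsActFreely {H : Subgroup (CoprodI G)} (h : FactorFreeI H) :
    FactorsActFreely G (CoprodI G ⧸ H) := by
  intro i g x
  induction x using QuotientGroup.induction_on with
  | H z =>
    intro hz
    rw [← QuotientGroup.mk_mul_of_mem z H.one_mem, mul_one] at hz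
    have : (((CoprodI.of g * z : CoprodI G)) : CoprodI G ⧸ H) = (z : CoprodI G ⧸ H) := hz
    rw [eq_comm, QuotientGroup.eq] at this
    exact factorFreeI_iff.1 h z i g (by simpa [mul_assoc] using this)

open CategoryTheory ActionCategory in
/-- Kurosh: factor-free subgroups of free products are free. -/
theorem FactorFreeI.isFreeGroup {H : Subgroup (CoprodI G)} (h : FactorFreeI H) :
    IsFreeGroup H := by
  let _ := h.factorsActFreely.isFreeGroupoid
  let r : ActionCategory (CoprodI G) (CoprodI G ⧸ H) :=
    objEquiv (CoprodI G) (CoprodI G ⧸ H) ((1 : CoprodI G) : CoprodI G ⧸ H)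
  let e := endMulEquivSubgroup H
  let e' : @End _ Groupoid.toCategory.toCategoryStruct r ≃* H :=
    MulEquiv.mk' e.toEquiv (fun x y => e.map_mul x y)
  have : @IsConnected (ActionCategory (CoprodI G) (CoprodI G ⧸ H)) Groupoid.toCategory :=
    inferInstanceAs (@IsConnected (ActionCategory (CoprodI G) (CoprodI G ⧸ H))
      (instCategoryActionCategory (CoprodI G) (CoprodI G ⧸ H)))
  have := IsFreeGroupoid.endIsFreeOfConnectedFree r
  exact IsFreeGroup.ofMulEquiv e'

end FactorFree

section Rank

variable {F F' : Type} [Group F] [Group F']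

theorem exists_finset_card_eq_rk {H : Subgroup F} (h : H.FG) :
    ∃ S : Finset F, S.card = rk H ∧ Subgroup.closure (S : Set F) = H := by
  obtain ⟨S, hS⟩ := h
  exact Nat.sInf_mem (s := {n : ℕ | ∃ S : Finset F, S.card = n ∧
    Subgroup.closure (S : Set F) = H}) ⟨_, S, rfl, hS⟩

theorem rk_le_card {H : Subgroup F} (S : Finset F) (hS : Subgroup.closure (S : Set F) = H) :
    rk H ≤ S.card :=
  Nat.sInf_le ⟨S, rfl, hS⟩

theorem exists_finset_closure_eq_map_iff {f : F →* F'} (hf : Function.Injective f)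
    {H : Subgroup F} {n : ℕ} :
    (∃ S : Finset F', S.card = n ∧ Subgroup.closure (S : Set F') = H.map f) ↔
      ∃ S : Finset F, S.card = n ∧ Subgroup.closure (S : Set F) = H := by
  classical
  constructor
  · rintro ⟨S, rfl, hS⟩
    have hsub : (S : Set F') ⊆ f '' (H : Set F) := by
      rw [← Subgroup.coe_map, ← hS]
      exact Subgroup.subset_closure
    have hinj : Set.InjOn f (f ⁻¹' (S : Set F')) := hf.injOn
    refine ⟨S.preimage f hinj, ?_, ?_⟩
    · rw [Finset.card_preimage, Finset.filter_true_of_mem]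
      intro x hx
      obtain ⟨y, -, rfl⟩ := hsub hx
      exact ⟨y, rfl⟩
    · apply Subgroup.map_injective hf
      rw [MonoidHom.map_closure, ← hS]
      congr 1
      rw [Finset.coe_preimage, Set.image_preimage_eq_of_subset]
      exact hsub.trans (Set.image_subset_range _ _)
  · rintro ⟨S, rfl, hS⟩
    refine ⟨S.image f, Finset.card_image_of_injective _ hf, ?_⟩
    rw [Finset.coe_image, ← MonoidHom.map_closure, hS]

theorem rk_map {f : F →* F'} (hf : Function.Injective f) (H : Subgroup F) :
    rk (H.map f) = rk H := by
  unfold rk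
  simp only [exists_finset_closure_eq_map_iff hf]

theorem fg_map_iff {f : F →* F'} (hf : Function.Injective f) {H : Subgroup F} :
    (H.map f).FG ↔ H.FG := by
  have := exists_congr fun n => exists_finset_closure_eq_map_iff (n := n) hf (H := H)
  constructor
  · rintro ⟨S, hS⟩
    obtain ⟨-, S, -, h⟩ := this.1 ⟨_, S, rfl, hS⟩
    exact ⟨S, h⟩
  · rintro ⟨S, hS⟩
    obtain ⟨-, S, -, h⟩ := this.2 ⟨_, S, rfl, hS⟩
    exact ⟨S, h⟩

theorem rk_conjS (t : F) (H : Subgroup F) : rk (conjS t H) = rk H :=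
  rk_map (MulAut.conj t).injective H

theorem rk_eq_rank {H : Subgroup F} (h : H.FG) :
    rk H = (@Group.rank H _ ((Group.fg_iff_subgroup_fg H).2 h)) := by
  classical
  have := (Group.fg_iff_subgroup_fg H).2 h
  have e : H = (⊤ : Subgroup H).map H.subtype := by
    rw [← MonoidHom.range_eq_map, Subgroup.range_subtype]
  obtain ⟨S, hS, hS2⟩ := Group.rank_spec H
  apply le_antisymm
  · rw [← hS]
    conv_lhs => rw [e, rk_map H.subtype_injective]
    exact rk_le_card S hS2
  · have h1 : rk (⊤ : Subgroup H) = rk H := by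
      conv_rhs => rw [e, rk_map H.subtype_injective]
    obtain ⟨T, hT, hT2⟩ := exists_finset_card_eq_rk (Group.fg_def.1 this)
    rw [← h1, ← hT]
    exact Group.rank_le hT2

/-- The group with two elements. -/
abbrev GroupTwo : Type := Multiplicative (ZMod 2)

theorem card_groupTwo : Nat.card GroupTwo = 2 := by
  simp [GroupTwo]

theorem finite_hom_and_card_le (H : Type) [Group H] [Group.FG H] :
    Finite (H →* GroupTwo) ∧ Nat.card (H →* GroupTwo) ≤ 2 ^ Group.rank H := by
  obtain ⟨S, hS, hS2⟩ := Group.rank_spec H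
  let r : (H →* GroupTwo) → (S → GroupTwo) := fun f s => f s
  have hr : Function.Injective r := by
    intro f g hfg
    apply MonoidHom.eq_of_eqOn_dense hS2
    intro x hx
    exact congrFun hfg ⟨x, hx⟩
  refine ⟨Finite.of_injective r hr, ?_⟩
  have := Nat.card_le_card_of_injective r hr
  rwa [Nat.card_fun, card_groupTwo, Nat.card_eq_fintype_card (α := S), Fintype.card_coe, hS] at this

theorem fg_and_le_card_hom {H : Subgroup F} [IsFreeGroup H] (h : Finite (H →* GroupTwo)) :
    H.FG ∧ 2 ^ rk H ≤ Nat.card (H →* GroupTwo) := by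
  classical
  let e : (IsFreeGroup.Generators H → GroupTwo) ≃ (H →* GroupTwo) := IsFreeGroup.lift
  have h1 : Finite (IsFreeGroup.Generators H → GroupTwo) := Finite.of_equiv _ e.symm
  have h2 : Finite (IsFreeGroup.Generators H) := by
    classical
    exact Finite.of_injective
      (fun x y => if x = y then (Multiplicative.ofAdd 1 : GroupTwo) else 1) fun x y hxy => by
        by_contra hne
        have := congrFun hxy y
        simp only [hne, if_false, if_true] at this
        exact absurd this (by decide)
  have := Fintype.ofFinite (IsFreeGroup.Generators H)
  let S : Finset F := Finset.univ.image fun x : IsFreeGroup.Generators H => ((IsFreeGroup.of x : H) : F)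
  have hS : Subgroup.closure (S : Set F) = H := by
    have h3 : Subgroup.closure (Set.range (IsFreeGroup.of : IsFreeGroup.Generators H → H)) = ⊤ := by
      have h4 : (IsFreeGroup.of : IsFreeGroup.Generators H → H) =
          (IsFreeGroup.mulEquiv H).toMonoidHom ∘ FreeGroup.of := rfl
      rw [h4, Set.range_comp, ← MonoidHom.map_closure, FreeGroup.closure_range_of,
        ← MonoidHom.range_eq_map, MonoidHom.range_eq_top]
      exact (IsFreeGroup.mulEquiv H).surjective
    have := congrArg (Subgroup.map H.subtype) h3
    rw [MonoidHom.map_closure, ← MonoidHom.range_eq_map, Subgroup.range_subtype] at this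
    rw [← this]
    congr 1
    ext
    simp [S]
  refine ⟨⟨S, hS⟩, ?_⟩
  rw [← Nat.card_congr e, Nat.card_fun, card_groupTwo]
  apply Nat.pow_le_pow_right (by norm_num)
  refine (rk_le_card S hS).trans (Finset.card_image_le.trans ?_)
  simp

theorem Noncyclic.two_le_rk {H : Subgroup F} (h : Noncyclic H) (hf : H.FG) : 2 ≤ rk H := by
  by_contra hlt
  obtain ⟨S, hS, hS2⟩ := exists_finset_card_eq_rk hf
  have hc : S.card = 0 ∨ S.card = 1 := by omega
  rcases hc with hc | hc
  · rw [Finset.card_eq_zero] at hc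
    apply h 1
    rw [← hS2, hc]
    simp [Subgroup.closure_singleton_one]
  · obtain ⟨a, rfl⟩ := Finset.card_eq_one.1 hc
    apply h a
    rw [← hS2]
    simp

theorem rrk_eq_zero_of_not_noncyclic {H : Subgroup F} (h : ¬ Noncyclic H) : rrk H = 0 := by
  simp only [Noncyclic, not_forall, not_not] at h
  obtain ⟨g, hg⟩ := h
  have : rk H ≤ 1 := rk_le_card {g} (by simp [hg])
  unfold rrk
  omega

theorem Noncyclic.map {f : F →* F'} (hf : Function.Injective f) {H : Subgroup F}
    (h : Noncyclic H) : Noncyclic (H.map f) := by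
  intro g hg
  have : g ∈ H.map f := by rw [hg]; exact Subgroup.mem_closure_singleton_self g
  obtain ⟨x, hx, rfl⟩ := this
  apply h x
  apply Subgroup.map_injective hf
  rw [hg, MonoidHom.map_closure, Set.image_singleton]

theorem noncyclic_map_iff {f : F →* F'} (hf : Function.Injective f) {H : Subgroup F} :
    Noncyclic (H.map f) ↔ Noncyclic H := by
  refine ⟨fun h g hg => h (f g) ?_, fun h => h.map hf⟩
  rw [hg, MonoidHom.map_closure, Set.image_singleton]

end Rank

section Cocycle

variable {F A : Type} [Group F] [CommGroup A] {X : Type} [MulAction F X]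

/-- A one-cocycle of `F` with values in the functions from the `F`-set `X` to `A`. -/
def IsCocycle (κ : F → X → A) : Prop := ∀ g h x, κ (g * h) x = κ g (h • x) * κ h x

theorem IsCocycle.one {κ : F → X → A} (hκ : IsCocycle κ) (x : X) : κ 1 x = 1 := by
  have := hκ 1 1 x
  simpa using this

theorem IsCocycle.conj {κ : F → X → A} (hκ : IsCocycle κ) {d s : F} {x : X}
    (h : d • s • x = s • x) : κ (s⁻¹ * d * s) x = κ d (s • x) := by
  have h1 : κ s⁻¹ (s • x) * κ s x = 1 := by rw [← hκ, inv_mul_cancel, hκ.one]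
  rw [hκ, hκ, h, mul_right_comm, h1, one_mul]

/-- Shapiro: homomorphisms on the stabilizers of points in distinct orbits extend to a
cocycle. -/
theorem exists_isCocycle_of_stabilizer {J : Type} (x : J → X)
    (hx : ∀ j k, (∃ g : F, g • x j = x k) → j = k)
    (f : ∀ j, MulAction.stabilizer F (x j) →* A) :
    ∃ κ : F → X → A, IsCocycle κ ∧
      ∀ (j : J) (d : F) (hd : d ∈ MulAction.stabilizer F (x j)), κ d (x j) = f j ⟨d, hd⟩ := by
  classical
  have key : ∀ y : X, ∃ t : F, ∀ j, (∃ g : F, g • x j = y) → t • x j = y := by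
    intro y
    by_cases h : ∃ j, ∃ g : F, g • x j = y
    · obtain ⟨j, g, hg⟩ := h
      refine ⟨g, fun k ⟨g', hg'⟩ => ?_⟩
      have : j = k := hx j k ⟨g'⁻¹ * g, by rw [mul_smul, hg, ← hg', inv_smul_smul]⟩
      rwa [← this]
    · exact ⟨1, fun k hk => absurd ⟨k, hk⟩ h⟩
  choose t ht using key
  have mem : ∀ (g : F) (y : X) (j : J), (∃ u : F, u • x j = y) →
      (t (g • y))⁻¹ * g * t y ∈ MulAction.stabilizer F (x j) := by
    rintro g y j ⟨u, hu⟩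
    rw [MulAction.mem_stabilizer_iff, mul_smul, mul_smul, ht y j ⟨u, hu⟩, inv_smul_eq_iff,
      ht (g • y) j ⟨g * u, by rw [mul_smul, hu]⟩]
  let κ : F → X → A := fun g y =>
    if h : ∃ j, ∃ u : F, u • x j = y then f h.choose ⟨_, mem g y h.choose h.choose_spec⟩ else 1
  have hκ : ∀ (g : F) (y : X) (j : J) (h : ∃ u : F, u • x j = y),
      κ g y = f j ⟨_, mem g y j h⟩ := by
    intro g y j h
    have h' : ∃ j, ∃ u : F, u • x j = y := ⟨j, h⟩
    have : h'.choose = j := by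
      obtain ⟨u, hu⟩ := h
      obtain ⟨v, hv⟩ := h'.choose_spec
      exact hx _ _ ⟨u⁻¹ * v, by rw [mul_smul, hv, ← hu, inv_smul_smul]⟩
    simp only [κ, h', dite_true]
    have gen : ∀ (k : J) (hk : k = j) (hm : (t (g • y))⁻¹ * g * t y ∈
        MulAction.stabilizer F (x k)), f k ⟨_, hm⟩ = f j ⟨_, mem g y j h⟩ := by
      rintro k rfl hm
      rfl
    exact gen _ this _
  refine ⟨κ, ?_, ?_⟩
  · intro g h y
    by_cases hy : ∃ j, ∃ u : F, u • x j = y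
    · obtain ⟨j, u, hu⟩ := hy
      rw [hκ (g * h) y j ⟨u, hu⟩, hκ g (h • y) j ⟨h * u, by rw [mul_smul, hu]⟩, hκ h y j ⟨u, hu⟩,
        ← map_mul]
      congr 1
      ext
      simp only [Subgroup.coe_mul, mul_smul]
      group
    · have hy' : ¬ ∃ j, ∃ u : F, u • x j = h • y := by
        rintro ⟨j, u, hu⟩
        exact hy ⟨j, h⁻¹ * u, by rw [mul_smul, hu, inv_smul_smul]⟩
      simp [κ, hy, hy']
  · intro j d hd
    rw [hκ d (x j) j ⟨1, one_smul _ _⟩]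
    have h1 : t (x j) ∈ MulAction.stabilizer F (x j) := ht (x j) j ⟨1, one_smul _ _⟩
    have hd' : d • x j = x j := hd
    have h2 : (⟨(t (d • x j))⁻¹ * d * t (x j), mem d (x j) j ⟨1, one_smul _ _⟩⟩ :
        MulAction.stabilizer F (x j)) = ⟨t (x j), h1⟩⁻¹ * ⟨d, hd⟩ * ⟨t (x j), h1⟩ := by
      ext
      simp [hd']
    rw [h2, map_mul, map_mul, map_inv, mul_right_comm, inv_mul_cancel, one_mul]

/-- Homomorphisms `j i` exhibiting `F` as generated by factors with the lifting property of
the coproduct. -/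
structure IsFreeProd {ι : Type} (G : ι → Type) [∀ i, Group (G i)] (F : Type) [Group F]
    (j : ∀ i, G i →* F) : Prop where
  lift : ∀ (B : Type) [Group B] (f : ∀ i, G i →* B), ∃ Φ : F →* B, ∀ i g, Φ (j i g) = f i g
  gen : ∀ p : F → Prop, p 1 → (∀ i g u, p u → p (j i g * u)) → ∀ u, p u

theorem isFreeProd_coprodI {ι : Type} (G : ι → Type) [∀ i, Group (G i)] :
    IsFreeProd G (CoprodI G) fun _ => CoprodI.of where
  lift B _ f := ⟨CoprodI.lift f, fun i g => by simp⟩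
  gen p h1 h u := by
    induction u using CoprodI.induction_left with
    | one => exact h1
    | mul m x ih => exact h _ m x ih

/-- Cocycles on the factors assemble to a cocycle on the free product. -/
theorem IsFreeProd.exists_isCocycle {ι : Type} {G : ι → Type} [∀ i, Group (G i)]
    {j : ∀ i, G i →* F} (hF : IsFreeProd G F j) (κ : ∀ i, G i → X → A)
    (hκ : ∀ i g h x, κ i (g * h) x = κ i g (j i h • x) * κ i h x) :
    ∃ C : F → X → A, IsCocycle C ∧ ∀ i g x, C (j i g) x = κ i g x := by
  have h1 : ∀ i x, κ i 1 x = 1 := fun i x => by simpa using hκ i 1 1 x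
  let act : ∀ i, G i →* Equiv.Perm (A × X) := fun i => MonoidHom.toHomPerm
    { toFun := fun g y => (κ i g y.2 * y.1, j i g • y.2)
      map_one' := by
        funext y
        change (κ i 1 y.2 * y.1, j i 1 • y.2) = y
        simp [h1]
      map_mul' := by
        intro g h
        funext y
        change (κ i (g * h) y.2 * y.1, j i (g * h) • y.2) =
          (κ i g (j i h • y.2) * (κ i h y.2 * y.1), j i g • j i h • y.2)
        rw [hκ, map_mul, mul_smul, mul_assoc] }
  have hact : ∀ i g y, act i g y = (κ i g y.2 * y.1, j i g • y.2) := fun _ _ _ => rfl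
  obtain ⟨Φ, hΦ⟩ := hF.lift _ act
  let C : F → X → A := fun u x => (Φ u (1, x)).1
  have hC : ∀ u y, Φ u y = (C u y.2 * y.1, u • y.2) := by
    intro u
    refine hF.gen (fun u => ∀ y, Φ u y = (C u y.2 * y.1, u • y.2)) ?_ ?_ u
    · intro y
      have e : C 1 y.2 = 1 := by
        change (Φ 1 (1, y.2)).1 = 1
        rw [map_one]
        rfl
      rw [e, map_one, one_mul, one_smul]
      rfl
    · intro i g u hu y
      have e : ∀ z, Φ (j i g * u) z = act i g (Φ u z) := fun z => by
        rw [map_mul, hΦ]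
        rfl
      have e2 : C (j i g * u) y.2 = κ i g (u • y.2) * C u y.2 := by
        change (Φ (j i g * u) (1, y.2)).1 = _
        rw [e, hu, hact, mul_one]
      rw [e, hu, hact, e2, mul_smul, mul_assoc]
  refine ⟨C, ?_, ?_⟩
  · intro g h x
    change (Φ (g * h) (1, x)).1 = _
    rw [map_mul, Equiv.Perm.mul_apply, hC h, hC g]
    simp
  · intro i g x
    change (Φ (j i g) (1, x)).1 = _
    rw [hΦ, hact]
    simp

end Cocycle

section Numeric

variable {F : Type} [Group F]

theorem fg_and_sum_rk_le {H2 : Subgroup F} (h2 : H2.FG) {Z : Type} [Finite Z] [MulAction F Z]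
    (z0 : Z) {J : Type} [Fintype J] (s : J → F) (D : J → Subgroup F)
    (hD : ∀ j, D j ≤ conjS (s j) H2) (hz : ∀ j, ∀ d ∈ D j, d • z0 = z0)
    (hfree : ∀ j, IsFreeGroup (D j))
    (hsurj : ∀ f : ∀ j, D j →* GroupTwo, ∃ C : F → Z × (F ⧸ H2) → GroupTwo, IsCocycle C ∧
      ∀ (j : J) (d : D j), C d (z0, ((s j : F) : F ⧸ H2)) = f j d) :
    (∀ j, (D j).FG) ∧ ∑ j, rk (D j) ≤ Nat.card Z ^ 2 * rk H2 := by
  classical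
  have := Fintype.ofFinite Z
  have hfg : Group.FG H2 := (Group.fg_iff_subgroup_fg H2).2 h2
  let K : Z → Subgroup H2 := fun z => MulAction.stabilizer H2 z
  have hidx : ∀ z, (K z).index ≠ 0 ∧ (K z).index ≤ Nat.card Z := by
    intro z
    rw [MulAction.index_stabilizer]
    refine ⟨?_, ?_⟩
    · exact ((Set.ncard_pos (Set.toFinite _)).2 (MulAction.nonempty_orbit z)).ne'
    · rw [← Set.ncard_univ]
      exact Set.ncard_le_ncard (Set.subset_univ _)
  have hKfin : ∀ z, (K z).FiniteIndex := fun z => ⟨(hidx z).1⟩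
  have hKfg : ∀ z, Group.FG (K z) := fun z => inferInstance
  have hcard : ∀ z, Nat.card (K z →* GroupTwo) ≤ 2 ^ (Nat.card Z * rk H2) := by
    intro z
    refine (finite_hom_and_card_le (K z)).2.trans ?_
    apply Nat.pow_le_pow_right (by norm_num)
    refine (Subgroup.rank_le_index_mul_rank (K z)).trans ?_
    rw [← rk_eq_rank h2]
    exact Nat.mul_le_mul_right _ (hidx z).2
  have hKhom : ∀ z, Finite (K z →* GroupTwo) := fun z => (finite_hom_and_card_le (K z)).1
  have hmem : ∀ j (d : D j), (s j)⁻¹ * d * s j ∈ H2 := fun j d => mem_conjS.1 (hD j d.2)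
  let c : ∀ j, D j →* K ((s j)⁻¹ • z0) := fun j =>
    { toFun := fun d => ⟨⟨(s j)⁻¹ * d * s j, hmem j d⟩, by
        change ((s j)⁻¹ * (d : F) * s j) • (s j)⁻¹ • z0 = _
        rw [mul_smul, mul_smul, smul_inv_smul, hz j d d.2]⟩
      map_one' := by
        ext
        simp
      map_mul' := by
        intro x y
        ext
        simp [mul_assoc] }
  let Θ : (∀ z, K z →* GroupTwo) → (∀ j, D j →* GroupTwo) := fun f j => (f _).comp (c j)
  have hΘ : Function.Surjective Θ := by
    intro f
    obtain ⟨C, hC, hCf⟩ := hsurj f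
    have hfix : ∀ (z : Z) (k : K z), ((k : H2) : F) • ((z, ((1 : F) : F ⧸ H2)) : Z × (F ⧸ H2)) =
        (z, ((1 : F) : F ⧸ H2)) := by
      intro z k
      ext
      · exact k.2
      · change ((((k : H2) : F) * 1 : F) : F ⧸ H2) = _
        rw [mul_one, eq_comm, QuotientGroup.eq]
        simp
    refine ⟨fun z => ⟨⟨fun k => C ((k : H2) : F) (z, ((1 : F) : F ⧸ H2)), ?_⟩, ?_⟩, ?_⟩
    · exact hC.one _
    · intro x y
      change C (((x : H2) : F) * ((y : H2) : F)) _ = _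
      rw [hC, hfix]
    · funext j
      ext1 d
      rw [← hCf j d]
      change C ((s j)⁻¹ * (d : F) * s j) ((s j)⁻¹ • z0, ((1 : F) : F ⧸ H2)) = _
      have e : s j • (((s j)⁻¹ • z0, ((1 : F) : F ⧸ H2)) : Z × (F ⧸ H2)) =
          (z0, ((s j : F) : F ⧸ H2)) := by
        ext
        · exact smul_inv_smul _ _
        · change ((s j * 1 : F) : F ⧸ H2) = _
          rw [mul_one]
      rw [hC.conj, e]
      rw [e]
      ext
      · exact hz j d d.2
      · change (((d : F) * s j : F) : F ⧸ H2) = _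
        rw [eq_comm, QuotientGroup.eq, ← mul_assoc]
        exact hmem j d
  have hfinpi : Finite (∀ j, D j →* GroupTwo) := Finite.of_surjective Θ hΘ
  have hfin : ∀ j, Finite (D j →* GroupTwo) := fun j =>
    Finite.of_surjective (fun f : ∀ j, D j →* GroupTwo => f j) (Function.surjective_eval j)
  have hfgr := fun j => fg_and_le_card_hom (hfin j)
  refine ⟨fun j => (hfgr j).1, ?_⟩
  rw [← Nat.pow_le_pow_iff_right (a := 2) (by norm_num), ← Finset.prod_pow_eq_pow_sum]
  calc ∏ j, 2 ^ rk (D j) ≤ ∏ j, Nat.card (D j →* GroupTwo) :=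
        Finset.prod_le_prod' fun j _ => (hfgr j).2
    _ = Nat.card (∀ j, D j →* GroupTwo) := Nat.card_pi.symm
    _ ≤ Nat.card (∀ z, K z →* GroupTwo) := Nat.card_le_card_of_surjective Θ hΘ
    _ = ∏ z, Nat.card (K z →* GroupTwo) := Nat.card_pi
    _ ≤ ∏ _z : Z, 2 ^ (Nat.card Z * rk H2) := Finset.prod_le_prod' fun z _ => hcard z
    _ = 2 ^ (Nat.card Z ^ 2 * rk H2) := by
        rw [Finset.prod_const, Finset.card_univ, ← Nat.card_eq_fintype_card, ← pow_mul]
        ring_nf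

end Numeric

section EPath

variable {ι : Type} {G : ι → Type} [∀ i, Group (G i)] {F : Type} [Group F] {j : ∀ i, G i →* F}
  {X : Type} [MulAction F X]

/-- The element `u` is a product of factor elements moving `z` through points marked by `E`:
each factor element of index `i` moves a point `y` with `(y, i) ∈ E` to another such point. -/
inductive EPath (j : ∀ i, G i →* F) (E : Set (X × ι)) (z : X) : F → Prop
  | one : EPath j E z 1
  | step {i : ι} (g : G i) {u : F} : EPath j E z u → (u • z, i) ∈ E → (j i g • u • z, i) ∈ E →
      EPath j E z (j i g * u)

theorem EPath.mono {E E' : Set (X × ι)} (hE : E ⊆ E') {z : X} {u : F} (h : EPath j E z u) :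
    EPath j E' z u := by
  induction h with
  | one => exact .one
  | step g _ h1 h2 ih => exact .step g ih (hE h1) (hE h2)

theorem EPath.trans {E : Set (X × ι)} {z : X} {u v : F} (h : EPath j E z u)
    (h' : EPath j E (u • z) v) : EPath j E z (v * u) := by
  induction h' with
  | one => rwa [one_mul]
  | step g _ h1 h2 ih =>
    rw [mul_assoc]
    exact .step g ih (by rwa [mul_smul]) (by rwa [mul_smul])

theorem EPath.symm {E : Set (X × ι)} {z : X} {u : F} (h : EPath j E z u) :
    EPath j E (u • z) u⁻¹ := by
  induction h with
  | one => simpa using EPath.one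
  | @step i g u _ h1 h2 ih =>
    rw [mul_inv_rev, ← map_inv]
    have e : (j i g⁻¹ * 1) • (j i g * u) • z = u • z := by
      simp [mul_smul]
    have h3 : EPath j E ((j i g * u) • z) (j i g⁻¹ * 1) := by
      refine .step _ .one ?_ ?_
      · rwa [one_smul, mul_smul]
      · rwa [one_smul, mul_smul, map_inv, inv_smul_smul]
    have := h3.trans (v := u⁻¹) (by rwa [e])
    rwa [mul_one] at this

theorem IsFreeProd.exists_finite_ePath (hF : IsFreeProd G F j) (z : X) (u : F) :
    ∃ E : Set (X × ι), E.Finite ∧ EPath j E z u := by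
  refine hF.gen (fun u => ∃ E : Set (X × ι), E.Finite ∧ EPath j E z u)
    ⟨∅, Set.finite_empty, .one⟩ ?_ u
  rintro i g u ⟨E, hE, h⟩
  refine ⟨insert (u • z, i) (insert (j i g • u • z, i) E), (hE.insert _).insert _, .step g ?_ ?_ ?_⟩
  · exact h.mono fun x hx => Or.inr (Or.inr hx)
  · exact Or.inl rfl
  · exact Or.inr (Or.inl rfl)

theorem IsFreeProd.exists_finite_ePath_of_fg (hF : IsFreeProd G F j) {z : X} {H : Subgroup F}
    (hH : H.FG) (hz : ∀ h ∈ H, h • z = z) :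
    ∃ E : Set (X × ι), E.Finite ∧ ∀ h ∈ H, EPath j E z h := by
  obtain ⟨T, hT⟩ := hH
  choose E hE hp using fun u : F => hF.exists_finite_ePath z u
  refine ⟨⋃ t ∈ T, E t, T.finite_toSet.biUnion fun t _ => hE t, ?_⟩
  subst hT
  intro h hh
  induction hh using Subgroup.closure_induction with
  | mem x hx => exact (hp x).mono (Set.subset_biUnion_of_mem (u := E) hx)
  | one => exact .one
  | mul x y hx hy ihx ihy => exact ihy.trans (by rwa [hz y hy])
  | inv x hx ih =>
    have := ih.symm
    rwa [hz x hx] at this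

/-- A version of Marshall Hall's theorem: for a free product of finite groups, a finitely
generated subgroup fixing `x0` fixes a point of a finite set on which cocycles look the same. -/
theorem IsFreeProd.exists_finite_model (hF : IsFreeProd G F j) [∀ i, Finite (G i)] (x0 : X)
    {H : Subgroup F} (hH : H.FG) (hx : ∀ h ∈ H, h • x0 = x0) (A : Type) [CommGroup A] :
    ∃ (Z : Type) (_ : Finite Z) (_ : MulAction F Z) (z0 : Z), (∀ h ∈ H, h • z0 = z0) ∧
      ∀ (Y : Type) [MulAction F Y] (C : F → X × Y → A), IsCocycle C →
        ∃ C' : F → Z × Y → A, IsCocycle C' ∧ ∀ h ∈ H, ∀ y, C' h (z0, y) = C h (x0, y) := by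
  classical
  obtain ⟨E, hE, hp⟩ := hF.exists_finite_ePath_of_fg hH hx
  let W : ι → Set X := fun i => {w | ∃ g, (j i g • w, i) ∈ E}
  have hW : ∀ i (g : G i) x, x ∈ W i → j i g • x ∈ W i := by
    rintro i g x ⟨h, hh⟩
    exact ⟨h * g⁻¹, by rwa [map_mul, mul_smul, map_inv, inv_smul_smul]⟩
  let S : Set X := {x0} ∪ ⋃ e ∈ E, Set.range fun g : G e.2 => j e.2 g • e.1
  have hS : S.Finite :=
    (Set.finite_singleton _).union (hE.biUnion fun e _ => Set.finite_range _)
  have hWS : ∀ i, W i ⊆ S := by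
    rintro i x ⟨g, hg⟩
    refine Or.inr (Set.mem_biUnion hg ⟨g⁻¹, ?_⟩)
    simp
  have hWE : ∀ i x, (x, i) ∈ E → x ∈ W i := fun i x h => ⟨1, by simpa using h⟩
  let f : ∀ i, G i →* Equiv.Perm S := fun i => MonoidHom.toHomPerm
    { toFun := fun g y => if h : y.1 ∈ W i then ⟨j i g • y.1, hWS i (hW i g _ h)⟩ else y
      map_one' := by
        funext y
        change (if h : y.1 ∈ W i then _ else y) = y
        split_ifs
        · ext
          simp
        · rfl
      map_mul' := by
        intro g h
        funext y
        change _ = dite _ _ _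
        by_cases hy : y.1 ∈ W i
        · simp [hy, hW i h _ hy, mul_smul]
        · simp [hy] }
  have hf : ∀ i g (y : S), (y.1 ∈ W i → (f i g y).1 = j i g • y.1) ∧ (y.1 ∉ W i → f i g y = y) := by
    intro i g y
    have e : f i g y = if h : y.1 ∈ W i then ⟨j i g • y.1, hWS i (hW i g _ h)⟩ else y := rfl
    constructor <;> intro h <;> simp [e, h]
  obtain ⟨Φ, hΦ⟩ := hF.lift _ f
  let act : MulAction F S := MulAction.compHom S Φ
  have hact : ∀ i g (y : S), j i g • y = f i g y := by
    intro i g y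
    rw [← hΦ]
    rfl
  let z0 : S := ⟨x0, Or.inl rfl⟩
  have hz0 : ∀ u, EPath j E x0 u → (u • z0).1 = u • x0 := by
    intro u hu
    induction hu with
    | one => simp [z0]
    | step g _ h1 h2 ih =>
      rw [mul_smul, mul_smul, hact, (hf _ _ _).1, ih]
      rw [ih]
      exact hWE _ _ h1
  refine ⟨S, hS, act, z0, fun h hh => Subtype.ext ?_, ?_⟩
  · rw [hz0 h (hp h hh), hx h hh]
  intro Y _ C hC
  let κ : ∀ i, G i → S × Y → A := fun i g p => if p.1.1 ∈ W i then C (j i g) (p.1.1, p.2) else 1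
  obtain ⟨C', hC', hκ⟩ := hF.exists_isCocycle κ (by
    rintro i g h ⟨z, y⟩
    by_cases hz : z.1 ∈ W i
    · have e1 : (j i h • z).1 = j i h • z.1 := by rw [hact, (hf i h z).1 hz]
      have e3 : j i h • z.1 ∈ W i := hW i h _ hz
      simp only [κ, Prod.smul_mk, hz, e1, e3, if_true, map_mul]
      exact hC _ _ _
    · have e1 : j i h • z = z := by rw [hact, (hf i h z).2 hz]
      simp only [κ, Prod.smul_mk, e1, hz, if_false, one_mul])
  refine ⟨C', hC', fun h hh y => ?_⟩
  have key : ∀ u, EPath j E x0 u → C' u (z0, y) = C u (x0, y) := by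
    intro u hu
    induction hu with
    | one => rw [hC'.one, hC.one]
    | @step i g u hu h1 h2 ih =>
      rw [hC', hC, ih, hκ]
      congr 1
      simp only [κ, Prod.smul_mk, hz0 u hu, hWE _ _ h1, if_true]
  exact key h (hp h hh)

end EPath

section Bounds

variable {F : Type} [Group F]

theorem smul_quotient_eq_iff {H : Subgroup F} {g s t : F} :
    g • ((s : F) : F ⧸ H) = ((t : F) : F ⧸ H) ↔ t⁻¹ * g * s ∈ H := by
  rw [mul_assoc]
  change ((g * s : F) : F ⧸ H) = _ ↔ _
  rw [eq_comm, QuotientGroup.eq]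

theorem isFreeGroup_of_le {H D : Subgroup F} (hH : IsFreeGroup H) (hD : D ≤ H) :
    IsFreeGroup D :=
  IsFreeGroup.ofMulEquiv (Subgroup.subgroupOfEquivOfLe hD)

theorem isFreeGroup_of_le_conjS {H D : Subgroup F} (hH : IsFreeGroup H) {s : F}
    (hD : D ≤ conjS s H) : IsFreeGroup D := by
  have h1 : IsFreeGroup (conjS s H) :=
    IsFreeGroup.ofMulEquiv (H.equivMapOfInjective _ (MulAut.conj s).injective)
  exact isFreeGroup_of_le h1 hD

theorem exists_sum_rk_inf_conjS_le {ι : Type} {G : ι → Type} [∀ i, Group (G i)]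
    [∀ i, Finite (G i)] {j : ∀ i, G i →* F} (hF : IsFreeProd G F j) {H1 : Subgroup F}
    (h1 : H1.FG) (hfree : IsFreeGroup H1) :
    ∃ N : ℕ, ∀ H2 : Subgroup F, H2.FG → ∀ (J : Type) [Fintype J] (s : J → F),
      (∀ a b, dcSetoid H1 H2 (s a) (s b) → a = b) →
        (∀ a, (H1 ⊓ conjS (s a) H2).FG) ∧ ∑ a, rk (H1 ⊓ conjS (s a) H2) ≤ N * rk H2 := by
  have hfix : ∀ h ∈ H1, h • ((1 : F) : F ⧸ H1) = ((1 : F) : F ⧸ H1) := fun h hh =>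
    smul_quotient_eq_iff.2 (by simpa using hh)
  obtain ⟨Z, hZ, _, z0, hz0, hmod⟩ := hF.exists_finite_model ((1 : F) : F ⧸ H1) h1 hfix GroupTwo
  refine ⟨Nat.card Z ^ 2, fun H2 h2 J _ s hs => ?_⟩
  refine fg_and_sum_rk_le h2 z0 s _ (fun a => inf_le_right) (fun a d hd => hz0 d hd.1)
    (fun a => isFreeGroup_of_le hfree inf_le_left) ?_
  intro f
  let x : J → (F ⧸ H1) × (F ⧸ H2) := fun a => (((1 : F) : F ⧸ H1), ((s a : F) : F ⧸ H2))
  have hst : ∀ a (d : F), d ∈ MulAction.stabilizer F (x a) ↔ d ∈ H1 ⊓ conjS (s a) H2 := by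
    intro a d
    rw [MulAction.mem_stabilizer_iff, Prod.ext_iff, Subgroup.mem_inf, mem_conjS]
    refine and_congr ?_ ?_
    · exact smul_quotient_eq_iff.trans (by simp)
    · exact smul_quotient_eq_iff
  obtain ⟨C, hC, hCf⟩ := exists_isCocycle_of_stabilizer x (by
    rintro a b ⟨g, hg⟩
    have hg1 : (1 : F)⁻¹ * g * 1 ∈ H1 := smul_quotient_eq_iff.1 (congrArg Prod.fst hg)
    have hg2 : (s b)⁻¹ * g * s a ∈ H2 := smul_quotient_eq_iff.1 (congrArg Prod.snd hg)
    refine hs a b ⟨g, by simpa using hg1, _, H2.inv_mem hg2, by group⟩)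
    (fun a => (f a).comp (Subgroup.inclusion fun d hd => (hst a d).1 hd))
  obtain ⟨C', hC', hCC⟩ := hmod (F ⧸ H2) C hC
  refine ⟨C', hC', fun a d => ?_⟩
  rw [hCC d d.2.1, hCf a d ((hst a d).2 d.2)]
  rfl

/-- Cocycles of `F'` on sets acted on by `F` extend to `F`. -/
def CocyclesExtend {F' : Type} [Group F'] (φ : F' →* F) : Prop :=
  ∀ (Y : Type) [MulAction F Y] (C : F' → Y → GroupTwo),
    (∀ g h y, C (g * h) y = C g (φ h • y) * C h y) →
      ∃ C' : F → Y → GroupTwo, IsCocycle C' ∧ ∀ g y, C' (φ g) y = C g y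

theorem fg_and_sum_rk_comap_le {F' : Type} [Group F'] {φ : F' →* F} (hφ : Function.Injective φ)
    (hext : CocyclesExtend φ) {H2 : Subgroup F} (h2 : H2.FG) (hfree : IsFreeGroup H2)
    {J : Type} [Fintype J] (s : J → F)
    (hs : ∀ a b, dcSetoid φ.range H2 (s a) (s b) → a = b) :
    (∀ a, ((conjS (s a) H2).comap φ).FG) ∧ ∑ a, rk ((conjS (s a) H2).comap φ) ≤ rk H2 := by
  let D : J → Subgroup F := fun a => ((conjS (s a) H2).comap φ).map φ
  have hD : ∀ a, D a ≤ conjS (s a) H2 := fun a => Subgroup.map_comap_le _ _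
  have := fg_and_sum_rk_le h2 PUnit.unit s D hD (fun _ _ _ => rfl)
    (fun a => isFreeGroup_of_le_conjS hfree (hD a)) (by
      intro f
      let _ : MulAction F' (F ⧸ H2) := MulAction.compHom _ φ
      let x : J → F ⧸ H2 := fun a => ((s a : F) : F ⧸ H2)
      have hst : ∀ a (d : F'), d ∈ MulAction.stabilizer F' (x a) ↔ φ d ∈ conjS (s a) H2 := by
        intro a d
        rw [MulAction.mem_stabilizer_iff, mem_conjS]
        exact smul_quotient_eq_iff
      let r : ∀ a, MulAction.stabilizer F' (x a) →* D a := fun a =>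
        (φ.comp (Subgroup.subtype _)).codRestrict (D a) fun d => ⟨d, (hst a d).1 d.2, rfl⟩
      obtain ⟨C, hC, hCf⟩ := exists_isCocycle_of_stabilizer x (by
        rintro a b ⟨g, hg⟩
        have hg2 : (s b)⁻¹ * φ g * s a ∈ H2 := smul_quotient_eq_iff.1 hg
        exact hs a b ⟨φ g, ⟨g, rfl⟩, _, H2.inv_mem hg2, by group⟩)
        (fun a => (f a).comp (r a))
      obtain ⟨C', hC', hCC⟩ := hext (F ⧸ H2) C hC
      refine ⟨fun u p => C' u p.2, fun g h p => hC' g h p.2, ?_⟩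
      rintro a ⟨-, d, hd, rfl⟩
      change C' (φ d) (x a) = _
      rw [hCC, hCf a d ((hst a d).2 hd)]
      rfl)
  refine ⟨fun a => (fg_map_iff hφ).1 (this.1 a), ?_⟩
  have h3 := this.2
  simp only [D, rk_map hφ] at h3
  simpa using h3

theorem sum_rrk_le {J : Type} [Fintype J] (K : J → Subgroup F) {r : ℕ} (h : ∑ a, rk (K a) ≤ r) :
    ∑ a, rrk (K a) ≤ r - 1 := by
  by_cases h0 : ∀ a, rk (K a) = 0
  · simp [rrk, h0]
  · push Not at h0
    obtain ⟨a, ha⟩ := h0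
    have h1 : ∑ b, rrk (K b) < ∑ b, rk (K b) :=
      Finset.sum_lt_sum (fun b _ => Nat.sub_le _ _)
        ⟨a, Finset.mem_univ a, Nat.sub_lt (Nat.pos_of_ne_zero ha) one_pos⟩
    omega

end Bounds

section OrbitGraph

variable {ι : Type} {M : ι → Type} [∀ i, Group (M i)] {X : Type} [MulAction (CoprodI M) X]

/-- The product in `∗_i M i` of a list of letters. -/
def letterProd (l : List (Σ i, M i)) : CoprodI M := (l.map fun x => CoprodI.of x.2).prod

theorem letterProd_nil : letterProd ([] : List (Σ i, M i)) = 1 := rfl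

theorem letterProd_cons (x : Σ i, M i) (l : List (Σ i, M i)) :
    letterProd (x :: l) = CoprodI.of x.2 * letterProd l := by simp [letterProd]

theorem letterProd_toList (w : CoprodI.Word M) : letterProd w.toList = w.prod := rfl

/-- Reading the letters of a list from right to left moves `o` through points marked by `S`. -/
def SuffixesIn (S : Set (X × ι)) (o : X) : List (Σ i, M i) → Prop
  | [] => True
  | x :: l => (letterProd l • o, x.1) ∈ S ∧
      ((CoprodI.of x.2 : CoprodI M) • letterProd l • o, x.1) ∈ S ∧ SuffixesIn S o l

theorem EPath.exists_word {S : Set (X × ι)} {o : X} {u : CoprodI M}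
    (h : EPath (fun i => (CoprodI.of : M i →* CoprodI M)) S o u) :
    ∃ w : CoprodI.Word M, w.prod = u ∧ SuffixesIn S o w.toList := by
  induction h with
  | one => exact ⟨CoprodI.Word.empty, by simp, trivial⟩
  | @step i g u _ h1 h2 ih =>
    obtain ⟨w, rfl, hw⟩ := ih
    by_cases hg : g = 1
    · exact ⟨w, by simp [hg], hw⟩
    obtain ⟨l, hne, hch⟩ := w
    rcases l with _ | ⟨⟨k, h⟩, l⟩
    · refine ⟨⟨[⟨i, g⟩], by simpa using hg, by simp⟩, by simp [CoprodI.Word.prod], ?_⟩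
      exact ⟨h1, h2, trivial⟩
    by_cases hik : k = i
    · subst hik
      have hl : ∀ x ∈ l, x.2 ≠ 1 := fun x hx => hne x (List.mem_cons_of_mem _ hx)
      have hc := (List.isChain_cons.1 hch)
      by_cases hgh : g * h = 1
      · refine ⟨⟨l, hl, hc.2⟩, ?_, hw.2.2⟩
        simp only [CoprodI.Word.prod, List.map_cons, List.prod_cons]
        rw [← mul_assoc, ← map_mul, hgh, map_one, one_mul]
      · refine ⟨⟨⟨k, g * h⟩ :: l, ?_, List.isChain_cons.2 hc⟩, ?_, hw.1, ?_, hw.2.2⟩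
        · rintro x hx
          rcases List.mem_cons.1 hx with rfl | hx
          · exact hgh
          · exact hl x hx
        · simp [CoprodI.Word.prod, mul_assoc]
        · rw [map_mul, mul_smul]
          rwa [← letterProd_toList, letterProd_cons, mul_smul] at h2
    · refine ⟨⟨⟨i, g⟩ :: ⟨k, h⟩ :: l, ?_, ?_⟩, by simp [CoprodI.Word.prod], h1, h2, hw⟩
      · intro x hx
        rcases List.mem_cons.1 hx with rfl | hx
        · exact hg
        · exact hne x hx
      · exact List.isChain_cons_cons.2 ⟨fun e => hik e.symm, hch⟩

theorem EPath.suffixesIn {S : Set (X × ι)} {o : X} {w : CoprodI.Word M}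
    (h : EPath (fun i => (CoprodI.of : M i →* CoprodI M)) S o w.prod) :
    SuffixesIn S o w.toList := by
  classical
  obtain ⟨w', hw', hs⟩ := h.exists_word
  obtain rfl : w' = w := (CoprodI.Word.equiv (M := M)).symm.injective hw'
  exact hs

/-- The graph with primary vertices the points occurring in `R`, secondary vertices the factor
orbits occurring in `R`, and a pair of mutually inverse edges for every element of `R`. -/
noncomputable def orbitGraph (M : ι → Type) [∀ i, Group (M i)] {X : Type}
    [MulAction (CoprodI M) X] (R : Set (X × ι)) : AGraph ι M where
  V := {x : X // ∃ i, (x, i) ∈ R} ⊕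
    {q : X × ι // ∃ x, (x, q.2) ∈ R ∧ orbitRep (G := M) q.2 x = q.1}
  E := R × Bool
  prim v := v.isLeft
  bar e := (e.1, !e.2)
  bar_bar e := by simp
  bar_ne e h := by simpa using congrArg Prod.snd h
  ini e := bif e.2 then .inl ⟨e.1.1.1, e.1.1.2, e.1.2⟩
    else .inr ⟨(orbitRep (G := M) e.1.1.2 e.1.1.1, e.1.1.2), e.1.1.1, e.1.2, rfl⟩
  ter e := bif e.2 then .inr ⟨(orbitRep (G := M) e.1.1.2 e.1.1.1, e.1.1.2), e.1.1.1, e.1.2, rfl⟩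
    else .inl ⟨e.1.1.1, e.1.1.2, e.1.2⟩
  ini_bar e := by rcases e with ⟨e, _ | _⟩ <;> rfl
  bipartite e := by rcases e with ⟨e, _ | _⟩ <;> simp
  typ v := v.elim (fun x => x.2.choose) fun q => q.1.2
  lab e := ⟨e.1.1.2, bif e.2 then orbitCoord e.1.1.2 e.1.1.1
    else (orbitCoord (G := M) e.1.1.2 e.1.1.1)⁻¹⟩
  lab_bar e := by rcases e with ⟨e, _ | _⟩ <;> simp
  lab_typ e h := by rcases e with ⟨e, _ | _⟩ <;> simp at h ⊢

/-- The point of `X` underlying a vertex of the orbit graph. -/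
def orbitPoint {R : Set (X × ι)} (v : (orbitGraph M R).V) : X :=
  Sum.elim (fun x => x.1) (fun q => q.1.1) v

theorem lab_smul_orbitPoint {R : Set (X × ι)} (e : (orbitGraph M R).E) :
    (CoprodI.of ((orbitGraph M R).lab e).2 : CoprodI M) •
      orbitPoint ((orbitGraph M R).ter e) = orbitPoint ((orbitGraph M R).ini e) := by
  rcases e with ⟨e, _ | _⟩
  · change (CoprodI.of (orbitCoord (G := M) e.1.2 e.1.1)⁻¹ : CoprodI M) • e.1.1 =
      orbitRep (G := M) e.1.2 e.1.1
    rw [map_inv, inv_smul_eq_iff, orbitCoord_smul]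
  · exact orbitCoord_smul _ _

theorem pathLabel_smul_orbitPoint {R : Set (X × ι)} (p : List (orbitGraph M R).E)
    (hp : (orbitGraph M R).IsPath p) (hne : p ≠ []) {a b : (orbitGraph M R).V}
    (ha : ∀ e ∈ p.head?, (orbitGraph M R).ini e = a)
    (hb : ∀ e ∈ p.getLast?, (orbitGraph M R).ter e = b) :
    (orbitGraph M R).pathLabel p • orbitPoint b = orbitPoint a := by
  induction p generalizing a with
  | nil => exact absurd rfl hne
  | cons e p ih =>
    obtain rfl := ha e (by simp)
    rcases p with _ | ⟨f, p⟩
    · obtain rfl := hb e (by simp)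
      simpa [AGraph.pathLabel] using lab_smul_orbitPoint e
    · have hc := List.isChain_cons_cons.1 hp
      have := ih hc.2 (by simp) (a := (orbitGraph M R).ter e) (by simpa using hc.1.symm)
        (by simpa using hb)
      rw [AGraph.pathLabel, List.map_cons, List.prod_cons, mul_smul]
      rw [AGraph.pathLabel] at this
      rw [this, lab_smul_orbitPoint]

theorem orbitGraph_finiteGraph {R : Set (X × ι)} (hR : R.Finite) :
    (orbitGraph M R).FiniteGraph := by
  have : Finite R := hR
  refine ⟨?_, inferInstanceAs (Finite (R × Bool))⟩
  have h1 : Finite {x : X // ∃ i, (x, i) ∈ R} := by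
    refine Finite.of_surjective (fun e : R => (⟨e.1.1, e.1.2, e.2⟩ : {x : X // ∃ i, (x, i) ∈ R})) ?_
    rintro ⟨x, i, h⟩
    exact ⟨⟨(x, i), h⟩, rfl⟩
  have h2 : Finite {q : X × ι // ∃ x, (x, q.2) ∈ R ∧ orbitRep (G := M) q.2 x = q.1} := by
    refine Finite.of_surjective (fun e : R =>
      (⟨(orbitRep (G := M) e.1.2 e.1.1, e.1.2), e.1.1, e.2, rfl⟩ :
        {q : X × ι // ∃ x, (x, q.2) ∈ R ∧ orbitRep (G := M) q.2 x = q.1})) ?_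
    rintro ⟨⟨r, i⟩, x, h, hr⟩
    exact ⟨⟨(x, i), h⟩, Subtype.ext (Prod.ext hr rfl)⟩
  exact inferInstanceAs (Finite (_ ⊕ _))

theorem one_lt_deg_orbitGraph {R : Set (X × ι)} (hR : R.Finite)
    {v : (orbitGraph M R).V} {e f : (orbitGraph M R).E} (hef : e ≠ f)
    (he : (orbitGraph M R).ter e = v) (hf : (orbitGraph M R).ter f = v) :
    1 < (orbitGraph M R).deg v := by
  have := (orbitGraph_finiteGraph (M := M) hR).2
  exact (Set.one_lt_ncard_iff (Set.toFinite _)).2 ⟨e, f, he, hf, hef⟩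

theorem deg_orbitGraph_pos {R : Set (X × ι)} (hR : R.Finite) (v : (orbitGraph M R).V) :
    0 < (orbitGraph M R).deg v := by
  have := (orbitGraph_finiteGraph (M := M) hR).2
  refine (Set.ncard_pos (Set.toFinite _)).2 ?_
  rcases v with ⟨x, i, h⟩ | ⟨⟨r, i⟩, x, h, hr⟩
  · exact ⟨(⟨(x, i), h⟩, false), rfl⟩
  · exact ⟨(⟨(x, i), h⟩, true), congrArg Sum.inr (Subtype.ext (Prod.ext hr rfl))⟩

theorem eq_base_of_deg_eq_one {R : Set (X × ι)} (hR : R.Finite) {o : X} (ho : ∃ i, (o, i) ∈ R)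
    (hprim : ∀ x i, (x, i) ∈ R → x ≠ o → ∃ i', i' ≠ i ∧ (x, i') ∈ R)
    (hsec : ∀ x i, (x, i) ∈ R → ∃ y, (y, i) ∈ R ∧ y ≠ x ∧
      orbitRep (G := M) i y = orbitRep (G := M) i x)
    (v : (orbitGraph M R).V) (hv : (orbitGraph M R).deg v = 1) :
    v = Sum.inl ⟨o, ho⟩ := by
  rcases v with ⟨x, i, h⟩ | ⟨⟨r, i⟩, x, h, hr⟩
  · by_contra hne
    have hxo : x ≠ o := fun e => hne (congrArg Sum.inl (Subtype.ext e))
    obtain ⟨i', hi', h'⟩ := hprim x i h hxo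
    refine (one_lt_deg_orbitGraph hR (e := (⟨(x, i), h⟩, false)) (f := (⟨(x, i'), h'⟩, false))
      ?_ rfl rfl).ne' hv
    exact fun e => hi' (congrArg (fun t : R × Bool => t.1.1.2) e).symm
  · obtain ⟨y, hy, hyx, hyr⟩ := hsec x i h
    refine absurd hv (one_lt_deg_orbitGraph hR (e := (⟨(x, i), h⟩, true))
      (f := (⟨(y, i), hy⟩, true)) ?_ ?_ ?_).ne'
    · exact fun e => hyx (congrArg (fun t : R × Bool => t.1.1.1) e).symm
    · exact congrArg Sum.inr (Subtype.ext (Prod.ext hr rfl))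
    · exact congrArg Sum.inr (Subtype.ext (Prod.ext (hyr.trans hr) rfl))

theorem orbitGraph_irr {R : Set (X × ι)} (hR : R.Finite) {o : X} (ho : ∃ i, (o, i) ∈ R)
    (hone : ∀ v : (orbitGraph M R).V, (orbitGraph M R).deg v = 1 → v = Sum.inl ⟨o, ho⟩) :
    (orbitGraph M R).Irr := by
  refine ⟨?_, ?_, ?_, deg_orbitGraph_pos hR, fun v w hv hw => (hone v hv).trans (hone w hw).symm,
    fun v hv => by rw [hone v hv]; exact rfl⟩
  · rintro ⟨⟨⟨x, i⟩, hx⟩, _ | _⟩ ⟨⟨⟨y, k⟩, hy⟩, _ | _⟩ h hp hne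
    · simp [orbitGraph] at hp
    · simp [orbitGraph] at hp
    · simp [orbitGraph] at h
    · have hxy : x = y := congrArg Subtype.val (Sum.inl.inj h)
      subst hxy
      rintro (hik : i = k)
      subst hik
      exact hne rfl
  · rintro ⟨⟨⟨x, i⟩, hx⟩, _ | _⟩ ⟨⟨⟨y, k⟩, hy⟩, _ | _⟩ hne h hp hl
    · exact hp rfl
    · simp [orbitGraph] at h
    · simp [orbitGraph] at h
    · have hxy := Prod.mk.inj (congrArg Subtype.val (Sum.inr.inj h))
      obtain ⟨h1, h2 : i = k⟩ := hxy
      subst h2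
      have h3 : orbitCoord (G := M) i x = orbitCoord (G := M) i y := by
        simpa [orbitGraph] using hl
      refine hne ?_
      have h4 : x = y := by
        rw [← orbitCoord_smul (G := M) i x, ← orbitCoord_smul (G := M) i y, h3]
        exact congrArg _ h1
      subst h4
      rfl
  · rintro ⟨⟨⟨x, i⟩, hx⟩, _ | _⟩ ⟨⟨⟨y, k⟩, hy⟩, _ | _⟩ h h'
    · have h1 : x = y := congrArg Subtype.val (Sum.inl.inj h')
      have h2 : i = k := congrArg (fun q => q.1.2) (Sum.inr.inj h)
      subst h1 h2
      rfl
    · simp [orbitGraph] at h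
    · simp [orbitGraph] at h
    · have h1 : x = y := congrArg Subtype.val (Sum.inl.inj h)
      have h2 : i = k := congrArg (fun q => q.1.2) (Sum.inr.inj h')
      subst h1 h2
      rfl

theorem deg_orbitGraph_le {R S : Set (X × ι)} (hRS : R ⊆ S) (hS : S.Finite) [Finite ι] {d : ℕ}
    (hι : Nat.card ι ≤ d)
    (hd : ∀ (i : ι) (r : X), {p | (p, i) ∈ S ∧ orbitRep (G := M) i p = r}.ncard ≤ d)
    (v : (orbitGraph M R).V) : (orbitGraph M R).deg v ≤ d := by
  rcases v with ⟨x, hx⟩ | ⟨⟨r, i⟩, hr⟩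
  · refine le_trans ?_ hι
    rw [← Set.ncard_univ]
    refine Set.ncard_le_ncard_of_injOn (fun e => e.1.1.2) (fun _ _ => trivial) ?_
      (Set.toFinite _)
    rintro ⟨⟨⟨y, k⟩, hy⟩, _ | _⟩ h ⟨⟨⟨z, l⟩, hz⟩, _ | _⟩ h' e
    · have h1 : y = x := congrArg Subtype.val (Sum.inl.inj h)
      have h2 : z = x := congrArg Subtype.val (Sum.inl.inj h')
      have h3 : k = l := e
      subst h1 h2 h3
      rfl
    · exact (Sum.inr_ne_inl h').elim
    · exact (Sum.inr_ne_inl h).elim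
    · exact (Sum.inr_ne_inl h).elim
  · refine le_trans ?_ (hd i r)
    refine Set.ncard_le_ncard_of_injOn (fun e => e.1.1.1) ?_ ?_ ?_
    · rintro ⟨⟨⟨y, k⟩, hy⟩, _ | _⟩ h
      · exact (Sum.inl_ne_inr h).elim
      · obtain ⟨h1, h2⟩ := Prod.mk.inj (congrArg Subtype.val (Sum.inr.inj h))
        have h2' : k = i := h2
        subst h2'
        exact ⟨hRS hy, h1⟩
    · rintro ⟨⟨⟨y, k⟩, hy⟩, _ | _⟩ h ⟨⟨⟨z, l⟩, hz⟩, _ | _⟩ h' e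
      · exact (Sum.inl_ne_inr h).elim
      · exact (Sum.inl_ne_inr h).elim
      · exact (Sum.inl_ne_inr h').elim
      · have h1 : k = i := congrArg (fun q => q.1.2) (Sum.inr.inj h)
        have h2 : l = i := congrArg (fun q => q.1.2) (Sum.inr.inj h')
        have h3 : y = z := e
        subst h1 h2 h3
        rfl
    · exact (hS.preimage ((Prod.mk_left_injective i).injOn)).subset fun p hp => hp.1

theorem AGraph.deg_core_le {ι : Type} {G : ι → Type} [∀ i, Group (G i)] (Ψ : AGraph ι G)
    (hΨ : Ψ.FiniteGraph) (v : Ψ.core.V) : Ψ.core.deg v ≤ Ψ.deg v.1 := by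
  have := hΨ.2
  refine Set.ncard_le_ncard_of_injOn Subtype.val ?_ (Subtype.val_injective.injOn) (Set.toFinite _)
  rintro e he
  exact congrArg Subtype.val he

end OrbitGraph

section SubgroupGraph

variable {ι : Type} {M : ι → Type} [∀ i, Group (M i)] {X : Type} [MulAction (CoprodI M) X]

/-- The marked points met when reading the reduced words of the stabilizer of `o`. -/
def stabMarks (M : ι → Type) [∀ i, Group (M i)] {X : Type} [MulAction (CoprodI M) X] (o : X) :
    Set (X × ι) :=
  {p | ∃ w : CoprodI.Word M, w.prod • o = o ∧ ∃ l x l', w.toList = l ++ x :: l' ∧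
    (p = (letterProd l' • o, x.1) ∨
      p = ((CoprodI.of x.2 : CoprodI M) • letterProd l' • o, x.1))}

theorem SuffixesIn.mem_of_eq_append {S : Set (X × ι)} {o : X} {l l' : List (Σ i, M i)}
    {x : Σ i, M i} (h : SuffixesIn S o (l ++ x :: l')) :
    (letterProd l' • o, x.1) ∈ S ∧
      ((CoprodI.of x.2 : CoprodI M) • letterProd l' • o, x.1) ∈ S := by
  induction l with
  | nil => exact ⟨h.1, h.2.1⟩
  | cons y l ih => exact ih h.2.2

theorem stabMarks_subset {S : Set (X × ι)} {o : X}
    (h : ∀ w : CoprodI.Word M, w.prod • o = o → SuffixesIn S o w.toList) :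
    stabMarks M o ⊆ S := by
  rintro p ⟨w, hw, l, x, l', hl, hp⟩
  have := h w hw
  rw [hl] at this
  rcases hp with rfl | rfl
  · exact this.mem_of_eq_append.1
  · exact this.mem_of_eq_append.2

theorem exists_mem_stabMarks_base {o : X} {k : CoprodI M} (hk : k • o = o) (hk1 : k ≠ 1) :
    ∃ i, (o, i) ∈ stabMarks M o := by
  classical
  obtain ⟨w, rfl⟩ := (CoprodI.Word.equiv (M := M)).symm.surjective k
  change w.prod • o = o at hk
  rcases List.eq_nil_or_concat w.toList with h | ⟨l, x, h⟩
  · exact absurd (by change w.prod = 1; simp [CoprodI.Word.prod, h]) hk1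
  · refine ⟨x.1, w, hk, l, x, [], by simpa using h, Or.inl ?_⟩
    simp [letterProd]

theorem exists_mem_stabMarks_ne {o x : X} {i : ι} (h : (x, i) ∈ stabMarks M o) (hx : x ≠ o) :
    ∃ i', i' ≠ i ∧ (x, i') ∈ stabMarks M o := by
  obtain ⟨w, hw, l, y, l', hl, hp⟩ := h
  have hch := w.chain_ne
  rw [hl, List.isChain_append] at hch
  rcases hp with hp | hp
  · obtain ⟨rfl, rfl⟩ := Prod.mk.inj hp
    rcases l' with _ | ⟨z, l'⟩
    · exact absurd (by simp [letterProd]) hx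
    · refine ⟨z.1, (List.isChain_cons_cons.1 hch.2.1).1.symm, w, hw, l ++ [y], z, l',
        by simp [hl], Or.inr ?_⟩
      rw [letterProd_cons, mul_smul]
  · obtain ⟨rfl, rfl⟩ := Prod.mk.inj hp
    rcases List.eq_nil_or_concat l with rfl | ⟨l, z, rfl⟩
    · refine absurd ?_ hx
      rw [← mul_smul, ← letterProd_cons, ← List.nil_append (y :: l'), ← hl, letterProd_toList, hw]
    · refine ⟨z.1, hch.2.2 z (by simp) y (by simp), w, hw, l, z, y :: l', by simp [hl], Or.inl ?_⟩
      rw [letterProd_cons, mul_smul]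

theorem exists_mem_stabMarks_orbit (hX : FactorsActFreely M X) {o x : X} {i : ι}
    (h : (x, i) ∈ stabMarks M o) :
    ∃ y, (y, i) ∈ stabMarks M o ∧ y ≠ x ∧ orbitRep (G := M) i y = orbitRep (G := M) i x := by
  obtain ⟨w, hw, l, y, l', hl, hp⟩ := h
  have hy : y.2 ≠ 1 := w.ne_one y (by simp [hl])
  have hne : (CoprodI.of y.2 : CoprodI M) • letterProd l' • o ≠ letterProd l' • o :=
    fun e => hy (hX _ _ _ e)
  rcases hp with hp | hp
  · obtain ⟨rfl, rfl⟩ := Prod.mk.inj hp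
    exact ⟨_, ⟨w, hw, l, y, l', hl, Or.inr rfl⟩, hne, orbitRep_smul _ _ _⟩
  · obtain ⟨rfl, rfl⟩ := Prod.mk.inj hp
    exact ⟨_, ⟨w, hw, l, y, l', hl, Or.inl rfl⟩, hne.symm, (orbitRep_smul _ _ _).symm⟩

/-- Every suffix of a reduced word of the stabilizer of `o` is the label of a reduced path to `o`
in the orbit graph. -/
theorem exists_redPath (hX : FactorsActFreely M X) {o : X} (w : CoprodI.Word M)
    (hw : w.prod • o = o) (l l' : List (Σ i, M i)) (hl : w.toList = l ++ l') :
    ∃ p : List (orbitGraph M (stabMarks M o)).E, (orbitGraph M (stabMarks M o)).IsRedPath p ∧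
      (orbitGraph M (stabMarks M o)).pathLabel p = letterProd l' ∧ p.length = 2 * l'.length ∧
      (∀ e ∈ p.head?, e.2 = true ∧ e.1.1.1 = letterProd l' • o ∧ ∀ x ∈ l'.head?, e.1.1.2 = x.1) ∧
      (∀ e ∈ p.getLast?, e.2 = false ∧ e.1.1.1 = o) := by
  induction l' generalizing l with
  | nil => exact ⟨[], List.IsChain.nil, by simp [AGraph.pathLabel, letterProd]⟩
  | cons x l' ih =>
    obtain ⟨p, hp, hlab, hlen, hhead, hlast⟩ := ih (l ++ [x]) (by simp [hl])
    have hm1 : (letterProd l' • o, x.1) ∈ stabMarks M o := ⟨w, hw, l, x, l', hl, Or.inl rfl⟩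
    have hm2 : ((CoprodI.of x.2 : CoprodI M) • letterProd l' • o, x.1) ∈ stabMarks M o :=
      ⟨w, hw, l, x, l', hl, Or.inr rfl⟩
    have hne : (CoprodI.of x.2 : CoprodI M) • letterProd l' • o ≠ letterProd l' • o :=
      fun e => w.ne_one x (by simp [hl]) (hX _ _ _ e)
    let a : (orbitGraph M (stabMarks M o)).E := (⟨_, hm2⟩, true)
    let b : (orbitGraph M (stabMarks M o)).E := (⟨_, hm1⟩, false)
    have hch := w.chain_ne
    rw [hl, List.isChain_append] at hch
    refine ⟨a :: b :: p, ?_, ?_, by simp [hlen]; ring, ?_, ?_⟩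
    · refine List.isChain_cons_cons.2 ⟨⟨?_, ?_⟩, List.isChain_cons.2 ⟨?_, hp⟩⟩
      · exact congrArg Sum.inr (Subtype.ext (Prod.ext (orbitRep_smul _ _ _) rfl))
      · exact fun e => hne (congrArg (fun t : stabMarks M o × Bool => t.1.1.1) e).symm
      · rintro ⟨⟨⟨y, k⟩, hy⟩, s⟩ he
        obtain ⟨h1, h2, h3⟩ := hhead _ he
        replace h1 : s = true := h1
        replace h2 : y = letterProd l' • o := h2
        subst h1 h2
        refine ⟨rfl, fun e => ?_⟩
        have hk : k = x.1 := congrArg (fun t : stabMarks M o × Bool => t.1.1.2) e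
        rcases l' with _ | ⟨z, l'⟩
        · have : p = [] := List.length_eq_zero_iff.1 (by simpa using hlen)
          rw [this] at he
          cases he
        · exact (List.isChain_cons_cons.1 hch.2.1).1 (hk.symm.trans (h3 z (by simp)))
    · rw [letterProd_cons, ← hlab, AGraph.pathLabel, List.map_cons, List.prod_cons, List.map_cons,
        List.prod_cons, ← mul_assoc]
      congr 1
      change (CoprodI.of (orbitCoord (G := M) x.1 ((CoprodI.of x.2 : CoprodI M) • letterProd l' • o))
        : CoprodI M) * CoprodI.of (orbitCoord (G := M) x.1 (letterProd l' • o))⁻¹ = _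
      rw [← map_mul, hX.orbitCoord_of_smul, mul_inv_cancel_right]
    · intro e he
      obtain rfl : a = e := by simpa using he
      refine ⟨rfl, ?_, ?_⟩
      · rw [letterProd_cons, mul_smul]
      · intro y hy
        obtain rfl : x = y := by simpa using hy
        rfl
    · intro e he
      rcases p with _ | ⟨f, p⟩
      · obtain rfl : b = e := by simpa using he
        have : l' = [] := List.length_eq_zero_iff.1 (by simpa using hlen.symm)
        subst this
        exact ⟨rfl, by simp [b, letterProd]⟩
      · exact hlast e (by simpa using he)

theorem orbitGraph_connected {o : X} (ho : ∃ i, (o, i) ∈ stabMarks M o) :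
    (orbitGraph M (stabMarks M o)).Connected := by
  set Ψ := orbitGraph M (stabMarks M o) with hΨ
  let r : Ψ.V → Ψ.V → Prop := fun a b => ∃ e : Ψ.E, Ψ.ini e = a ∧ Ψ.ter e = b
  have hsymm : ∀ a b, Relation.ReflTransGen r a b → Relation.ReflTransGen r b a := by
    intro a b h
    induction h with
    | refl => exact .refl
    | tail _ h ih =>
      obtain ⟨e, rfl, rfl⟩ := h
      exact .head ⟨Ψ.bar e, Ψ.ini_bar e, by rw [← Ψ.ini_bar, Ψ.bar_bar]⟩ ih
  have hsuf : ∀ (w : CoprodI.Word M), w.prod • o = o → ∀ l' l : List (Σ i, M i),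
      w.toList = l ++ l' → ∀ x h, x = letterProd l' • o → Relation.ReflTransGen r
        (Sum.inl ⟨x, h⟩ : Ψ.V) (Sum.inl ⟨o, ho⟩ : Ψ.V) := by
    intro w hw l'
    induction l' with
    | nil =>
      intro l _ x h hx
      obtain rfl : x = o := by rw [hx, letterProd_nil, one_smul]
      exact .refl
    | cons y l' ih =>
      intro l hl x h hx
      have hm1 : (letterProd l' • o, y.1) ∈ stabMarks M o := ⟨w, hw, l, y, l', hl, Or.inl rfl⟩
      have hm2 : ((CoprodI.of y.2 : CoprodI M) • letterProd l' • o, y.1) ∈ stabMarks M o :=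
        ⟨w, hw, l, y, l', hl, Or.inr rfl⟩
      refine .head ⟨(⟨_, hm2⟩, true), ?_, rfl⟩ (.head ⟨(⟨_, hm1⟩, false), ?_, rfl⟩
        (ih (l ++ [y]) (by simp [hl]) _ ⟨_, hm1⟩ rfl))
      · refine congrArg Sum.inl (Subtype.ext ?_)
        change _ = x
        rw [hx, letterProd_cons, mul_smul]
      · exact congrArg Sum.inr (Subtype.ext (Prod.ext (orbitRep_smul _ _ _).symm rfl))
  have hprim : ∀ x h, Relation.ReflTransGen r (Sum.inl ⟨x, h⟩ : Ψ.V) (Sum.inl ⟨o, ho⟩ : Ψ.V) := by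
    rintro x ⟨i, w, hw, l, y, l', hl, hp⟩
    rcases hp with hp | hp
    · exact hsuf w hw l' (l ++ [y]) (by simp [hl]) _ _ (Prod.mk.inj hp).1
    · refine hsuf w hw (y :: l') l hl _ _ ?_
      rw [letterProd_cons, mul_smul]
      exact (Prod.mk.inj hp).1
  have hbase : ∀ v, Relation.ReflTransGen r v (Sum.inl ⟨o, ho⟩ : Ψ.V) := by
    rintro (⟨x, h⟩ | ⟨⟨q, i⟩, x, h, hq⟩)
    · exact hprim x h
    · refine .head ⟨(⟨(x, i), h⟩, false), ?_, rfl⟩ (hprim x ⟨i, h⟩)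
      exact congrArg Sum.inr (Subtype.ext (Prod.ext hq rfl))
  exact fun u v => (hbase u).trans (hsymm _ _ (hbase v))

/-- A nontrivial stabilizer whose elements move `o` through a finite set of marked points has an
irreducible core graph of bounded degree. -/
theorem exists_isIrrCoreGraphOf (hX : FactorsActFreely M X) [Finite ι] {o : X}
    {K : Subgroup (CoprodI M)} (hK : ∀ w, w ∈ K ↔ w • o = o) (hne : K ≠ ⊥) {S : Set (X × ι)}
    (hS : S.Finite) (hpath : ∀ k ∈ K, EPath (fun i => (CoprodI.of : M i →* CoprodI M)) S o k)
    {d : ℕ} (hι : Nat.card ι ≤ d)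
    (hd : ∀ (i : ι) (r : X), {p | (p, i) ∈ S ∧ orbitRep (G := M) i p = r}.ncard ≤ d) :
    ∃ Ψ : AGraph ι M, IsIrrCoreGraphOf Ψ K ∧ ∀ v, Ψ.deg v ≤ d := by
  have hRS : stabMarks M o ⊆ S :=
    stabMarks_subset fun w hw => (hpath _ ((hK _).2 hw)).suffixesIn
  have hR := hS.subset hRS
  obtain ⟨k, hk, hk1⟩ := (Subgroup.bot_or_exists_ne_one K).resolve_left hne
  have ho := exists_mem_stabMarks_base ((hK _).1 hk) hk1
  have hone := eq_base_of_deg_eq_one hR ho (fun x i => exists_mem_stabMarks_ne)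
    (fun x i => exists_mem_stabMarks_orbit hX)
  refine ⟨(orbitGraph M (stabMarks M o)).core, ⟨orbitGraph M (stabMarks M o), Sum.inl ⟨o, ho⟩,
    ⟨orbitGraph_finiteGraph hR, orbitGraph_connected ho, orbitGraph_irr hR ho hone, ?_, hone, ?_⟩,
    rfl⟩, fun v => (AGraph.deg_core_le _ (orbitGraph_finiteGraph hR) v).trans
      (deg_orbitGraph_le hRS hS hι hd _)⟩
  · exact (rfl : true = true)
  intro w
  constructor
  · intro hw
    obtain ⟨p, hp, hlab, hlen, hhead, hlast⟩ := exists_redPath hX w ((hK _).1 hw) [] w.toList rfl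
    refine ⟨p, hp, ⟨?_, ?_⟩, hlab, hlen⟩
    · rintro ⟨⟨⟨y, i⟩, hy⟩, s⟩ he
      obtain ⟨h1, h2, -⟩ := hhead _ he
      replace h1 : s = true := h1
      subst h1
      exact congrArg Sum.inl (Subtype.ext (h2.trans ((hK _).1 hw)))
    · rintro ⟨⟨⟨y, i⟩, hy⟩, s⟩ he
      obtain ⟨h1, h2⟩ := hlast _ he
      replace h1 : s = false := h1
      subst h1
      exact congrArg Sum.inl (Subtype.ext h2)
  · rintro ⟨p, hp, ⟨h1, h2⟩, hlab, -⟩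
    rw [← hlab]
    by_cases hnil : p = []
    · subst hnil
      exact K.one_mem
    · exact (hK _).2 (pathLabel_smul_orbitPoint p (List.IsChain.imp (fun _ _ h => h.1) hp) hnil h1 h2)

end SubgroupGraph

section ReducedForms

variable {ι : Type} {N : ι → Type} [∀ i, Group (N i)]

theorem eq_one_of_of_eq_of {i k : ι} (hik : i ≠ k) {m : N i} {n : N k}
    (h : (CoprodI.of m : CoprodI N) = CoprodI.of n) : n = 1 := by
  classical
  have := congrArg (CoprodI.lift (Pi.mulSingle k (MonoidHom.id (N k)))) h
  rw [CoprodI.lift_of, CoprodI.lift_of, Pi.mulSingle_eq_same, Pi.mulSingle_eq_of_ne hik] at this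
  simpa using this.symm

/-- `u` has a reduced form whose first letter has index `i` and whose last letter has index `k`. -/
def IsReducedFrom (i k : ι) (u : CoprodI N) : Prop := ∃ w : CoprodI.NeWord N i k, w.prod = u

/-- `u` has a reduced form with at least two letters, the first one of index `i` and the last one
of index `k`. -/
def IsLongFrom (i k : ι) (u : CoprodI N) : Prop :=
  ∃ w : CoprodI.NeWord N i k, w.prod = u ∧ 2 ≤ w.toList.length

theorem IsLongFrom.isReducedFrom {i k : ι} {u : CoprodI N} (h : IsLongFrom i k u) :
    IsReducedFrom i k u := h.imp fun _ h => h.1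

theorem isReducedFrom_of {i : ι} {m : N i} (hm : m ≠ 1) :
    IsReducedFrom i i (CoprodI.of m : CoprodI N) := ⟨.singleton m hm, by simp⟩

theorem IsReducedFrom.mul {i k k' l : ι} {u v : CoprodI N} (hu : IsReducedFrom i k u)
    (hkk' : k ≠ k') (hv : IsReducedFrom k' l v) : IsLongFrom i l (u * v) := by
  obtain ⟨w, rfl⟩ := hu
  obtain ⟨w', rfl⟩ := hv
  refine ⟨.append w hkk' w', by simp, ?_⟩
  have h1 := List.length_pos_iff.2 w.toList_ne_nil
  have h2 := List.length_pos_iff.2 w'.toList_ne_nil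
  rw [CoprodI.NeWord.toList, List.length_append]
  omega

theorem IsReducedFrom.inv {i k : ι} {u : CoprodI N} (hu : IsReducedFrom i k u) :
    IsReducedFrom k i u⁻¹ := by
  obtain ⟨w, rfl⟩ := hu
  exact ⟨w.inv, by simp⟩

theorem IsLongFrom.ne_of {i k l : ι} {u : CoprodI N} (h : IsLongFrom i k u) (m : N l) :
    u ≠ CoprodI.of m := by
  classical
  rintro rfl
  obtain ⟨w, hw, hl⟩ := h
  have hinj := (CoprodI.Word.equiv (M := N)).symm.injective
  by_cases hm : m = 1
  · have : w.toWord = CoprodI.Word.empty := hinj (by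
      change w.prod = CoprodI.Word.empty.prod
      rw [hw, hm, map_one, CoprodI.Word.prod_empty])
    exact w.toList_ne_nil (congrArg CoprodI.Word.toList this)
  · have : w.toWord = (CoprodI.NeWord.singleton m hm).toWord := hinj (by
      change w.prod = (CoprodI.NeWord.singleton m hm).prod
      rw [hw, CoprodI.NeWord.prod_singleton])
    have h' : w.toList = [⟨l, m⟩] := congrArg CoprodI.Word.toList this
    simp [h'] at hl

theorem exists_isReducedFrom {u : CoprodI N} (hu : u ≠ 1) : ∃ i k, IsReducedFrom i k u := by
  classical
  obtain ⟨w, rfl⟩ := (CoprodI.Word.equiv (M := N)).symm.surjective u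
  change w.prod ≠ 1 at hu
  obtain ⟨i, k, w', rfl⟩ := CoprodI.NeWord.of_word w (by rintro rfl; exact hu (by simp))
  exact ⟨i, k, w', rfl⟩

end ReducedForms

section Embedding

variable {κ : Type} {P : Option κ → Type} [∀ α, Group (P α)] {N : Bool → Type} [∀ i, Group (N i)]
  (p : CoprodI (fun a : κ => P (some a)) ≃* N true) (q : P none ≃* N false)

/-- The embedding of the factor `P α` in one of the two groups `N true ≃ ∗_a P (some a)` and
`N false ≃ P none`. -/
def sideHom : ∀ α : Option κ, P α →* N α.isSome
  | none => q.toMonoidHom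
  | some a => p.toMonoidHom.comp (CoprodI.of (M := fun a => P (some a)) (i := a))

theorem sideHom_injective (α : Option κ) : Function.Injective (sideHom p q α) := by
  cases α with
  | none => exact q.injective
  | some a => exact p.injective.comp (CoprodI.of_injective a)

/-- The embedding of the factor `P α` in `N true ∗ N false`. -/
def sideInclusion (α : Option κ) : P α →* CoprodI N := CoprodI.of.comp (sideHom p q α)

theorem isFreeProd_sideInclusion : IsFreeProd P (CoprodI N) (sideInclusion p q) where
  lift B _ f := by
    refine ⟨CoprodI.lift fun i => match i with
      | true => (CoprodI.lift fun a => f (some a)).comp p.symm.toMonoidHom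
      | false => (f none).comp q.symm.toMonoidHom, ?_⟩
    rintro (_ | a) g
    · simp [sideInclusion, sideHom]
    · simp [sideInclusion, sideHom]
  gen r h1 hr u := by
    have key : ∀ u v : CoprodI N, r v → r (u * v) := by
      intro u
      induction u using CoprodI.induction_on with
      | one => simp
      | mul x y hx hy => intro v hv; rw [mul_assoc]; exact hx _ (hy _ hv)
      | of i m =>
        cases i with
        | false =>
          intro v hv
          have := hr none (q.symm m) v hv
          simpa [sideInclusion, sideHom] using this
        | true =>
          obtain ⟨c, rfl⟩ := p.surjective m
          induction c using CoprodI.induction_on with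
          | one => simp
          | mul x y hx hy =>
            intro v hv; rw [map_mul, map_mul, mul_assoc]; exact hx _ (hy _ hv)
          | of a g => exact fun v hv => hr (some a) g v hv
    simpa using key u 1 h1

variable (g : ∀ a, P (some a)) (t : P none)

/-- The first factors of the conjugating elements. -/
def twistLeft : Option κ → N true
  | none => 1
  | some a => p (CoprodI.of (M := fun a => P (some a)) (g a))

/-- The conjugating elements of the embedding of `∗_α P α` in `N true ∗ N false`. -/
def twist : Option κ → CoprodI N
  | none => 1
  | some a => CoprodI.of (p (CoprodI.of (M := fun a => P (some a)) (g a))) * CoprodI.of (q t)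

/-- The homomorphism from `∗_α P α` to `N true ∗ N false` given by conjugating the factor
embeddings by distinct elements. -/
def twistHom : CoprodI P →* CoprodI N :=
  CoprodI.lift fun α => (MulAut.conj (twist p q g t α)).toMonoidHom.comp (sideInclusion p q α)

theorem twistHom_of (α : Option κ) (b : P α) :
    twistHom p q g t (CoprodI.of b) =
      twist p q g t α * sideInclusion p q α b * (twist p q g t α)⁻¹ := by
  simp [twistHom]

variable {g t}

theorem isLongFrom_inv_twist_mul_twist (hg : ∀ a, g a ≠ 1) (ht : t ≠ 1) {α β : Option κ}
    (h : α ≠ β) :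
    IsLongFrom (!α.isSome) (!β.isSome) ((twist p q g t α)⁻¹ * twist p q g t β) := by
  have hp : ∀ a, p (CoprodI.of (M := fun a => P (some a)) (g a)) ≠ 1 := fun a e =>
    hg a (CoprodI.of_injective (M := fun a => P (some a)) a (p.injective (by simpa using e)))
  have hq : q t ≠ 1 := fun e => ht (q.injective (by simpa using e))
  have hlong : ∀ a, IsLongFrom true false (twist p q g t (some a)) := fun a =>
    (isReducedFrom_of (hp a)).mul (by simp) (isReducedFrom_of hq)
  rcases α with _ | a <;> rcases β with _ | b
  · exact absurd rfl h
  · simpa [twist] using hlong b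
  · obtain ⟨w, hw, hl⟩ := hlong a
    have := (isReducedFrom_of hq).inv.mul (by simp) (isReducedFrom_of (hp a)).inv
    simpa [twist] using this
  · have hab : a ≠ b := fun e => h (congrArg some e)
    have hne : p ((CoprodI.of (M := fun a => P (some a)) (g a))⁻¹ *
        CoprodI.of (M := fun a => P (some a)) (g b)) ≠ 1 := by
      intro e
      have e' : (CoprodI.of (M := fun a => P (some a)) (g a))⁻¹ *
          CoprodI.of (M := fun a => P (some a)) (g b) = 1 := p.injective (by rw [e, map_one])
      exact hg b (eq_one_of_of_eq_of hab (inv_mul_eq_one.1 e'))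
    have := ((isReducedFrom_of hq).inv.mul (by simp) (isReducedFrom_of hne)).isReducedFrom.mul
      (by simp) (isReducedFrom_of hq)
    simpa [twist, mul_assoc] using this

theorem twistHom_neWord (hg : ∀ a, g a ≠ 1) (ht : t ≠ 1) {α β : Option κ}
    (w : CoprodI.NeWord P α β) :
    ∃ d, twistHom p q g t w.prod = twist p q g t α * d * (twist p q g t β)⁻¹ ∧
      IsReducedFrom α.isSome β.isSome d ∧
      (IsLongFrom α.isSome β.isSome d ∨ α = β ∧ ∃ b : P α, w.prod = CoprodI.of b) := by
  induction w with
  | @singleton α x hx =>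
    refine ⟨sideInclusion p q α x, by simp [twistHom_of], ?_, Or.inr ⟨rfl, x, by simp⟩⟩
    exact isReducedFrom_of fun e => hx (sideHom_injective p q α (by simpa using e))
  | @append i k k' l w hne w' ih ih' =>
    obtain ⟨d, hd, hr, -⟩ := ih
    obtain ⟨d', hd', hr', -⟩ := ih'
    have hm := (isLongFrom_inv_twist_mul_twist p q hg ht hne).isReducedFrom
    have := (hr.mul (Bool.self_ne_not _) hm).isReducedFrom.mul (Bool.not_ne_self _) hr'
    refine ⟨_, ?_, this.isReducedFrom, Or.inl this⟩
    rw [CoprodI.NeWord.append_prod, map_mul, hd, hd']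
    group

/-- An element `u` with `z_α⁻¹ φ(u) z_β` in one of the two factors lies in `P α`, and `α = β`. -/
theorem eq_of_twistHom_eq (hg : ∀ a, g a ≠ 1) (ht : t ≠ 1) {α β : Option κ} {u : CoprodI P}
    {i : Bool} {m : N i}
    (h : (twist p q g t α)⁻¹ * twistHom p q g t u * twist p q g t β = CoprodI.of m) :
    α = β ∧ ∃ b : P α, u = CoprodI.of b := by
  by_cases hu : u = 1
  · subst hu
    by_cases hαβ : α = β
    · exact ⟨hαβ, 1, by simp⟩
    · rw [map_one, mul_one] at h
      exact absurd h ((isLongFrom_inv_twist_mul_twist p q hg ht hαβ).ne_of m)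
  obtain ⟨γ, γ', w, rfl⟩ := exists_isReducedFrom hu
  obtain ⟨d, hd, hr, hl⟩ := twistHom_neWord p q hg ht w
  rw [hd] at h
  have h' : (twist p q g t α)⁻¹ * twist p q g t γ * d *
      ((twist p q g t γ')⁻¹ * twist p q g t β) = CoprodI.of m := by rw [← h]; group
  by_cases h1 : α = γ
  · subst h1
    rw [inv_mul_cancel, one_mul] at h'
    by_cases h2 : γ' = β
    · subst h2
      rw [inv_mul_cancel, mul_one] at h'
      rcases hl with hl | hl
      · exact absurd h' (hl.ne_of m)
      · exact hl
    · have := hr.mul (Bool.self_ne_not _) (isLongFrom_inv_twist_mul_twist p q hg ht h2).isReducedFrom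
      exact absurd h' (this.ne_of m)
  · have hm := ((isLongFrom_inv_twist_mul_twist p q hg ht h1).isReducedFrom).mul (Bool.not_ne_self _) hr
    by_cases h2 : γ' = β
    · subst h2
      rw [inv_mul_cancel, mul_one] at h'
      exact absurd h' (hm.ne_of m)
    · have := hm.isReducedFrom.mul (Bool.self_ne_not _)
        (isLongFrom_inv_twist_mul_twist p q hg ht h2).isReducedFrom
      exact absurd h' (this.ne_of m)

theorem twistHom_injective (hg : ∀ a, g a ≠ 1) (ht : t ≠ 1) :
    Function.Injective (twistHom p q g t) := by
  refine (injective_iff_map_eq_one _).2 fun u hu => ?_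
  obtain ⟨-, b, rfl⟩ := eq_of_twistHom_eq p q hg ht (α := none) (β := none) (u := u) (i := true)
    (m := 1) (by simp [hu])
  rw [twistHom_of, conj_eq_one_iff] at hu
  have : b = 1 := sideHom_injective p q none (CoprodI.of_injective _ (by simpa [sideInclusion] using hu))
  rw [this, map_one]

end Embedding

section Marks

variable {κ : Type} {P : Option κ → Type} [∀ α, Group (P α)] {N : Bool → Type} [∀ i, Group (N i)]
  (p : CoprodI (fun a : κ => P (some a)) ≃* N true) (q : P none ≃* N false)
  (g : ∀ a, P (some a)) (t : P none)

/-- The elements `c` such that `c z_α⁻¹ φ(u)` is a marked point of index `i`. -/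
def markSet : Option κ → ∀ i : Bool, Set (N i)
  | none, true => Set.range fun γ => (twistLeft p g γ)⁻¹
  | none, false => {1}
  | some _, true => {1}
  | some _, false => {1, q t}

/-- The marked points of the coset space of the image of `K` for a set `V` of cosets of `K`. -/
def marks (K : Subgroup (CoprodI P)) (V : Set (CoprodI P ⧸ K)) :
    Set ((CoprodI N ⧸ K.map (twistHom p q g t)) × Bool) :=
  {y | ∃ u : CoprodI P, (u : CoprodI P ⧸ K) ∈ V ∧ ∃ α, ∃ c ∈ markSet p q g t α y.2,
    y.1 = ((CoprodI.of c * (twist p q g t α)⁻¹ * twistHom p q g t u : CoprodI N) :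
      CoprodI N ⧸ K.map (twistHom p q g t))}

variable {K : Subgroup (CoprodI P)}

theorem one_mem_markSet (α : Option κ) (i : Bool) : (1 : N i) ∈ markSet p q g t α i := by
  rcases α with _ | a <;> cases i
  · rfl
  · exact ⟨none, by simp [twistLeft]⟩
  · exact Or.inl rfl
  · rfl

theorem markSet_isSome (α : Option κ) : markSet p q g t α α.isSome = {1} := by
  cases α <;> rfl

theorem finite_markSet [Finite κ] (α : Option κ) (i : Bool) : (markSet p q g t α i).Finite := by
  rcases α with _ | a <;> cases i
  · exact Set.finite_singleton _
  · exact Set.finite_range _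
  · exact (Set.finite_singleton _).insert _
  · exact Set.finite_singleton _

theorem ncard_markSet_le [Finite κ] {d : ℕ} (hd : 2 ≤ d) (hκ : Nat.card (Option κ) ≤ d)
    (α : Option κ) (i : Bool) : (markSet p q g t α i).ncard ≤ d := by
  have h1 : ({1} : Set (N i)).ncard ≤ d := by rw [Set.ncard_singleton]; omega
  rcases α with _ | a <;> cases i
  · exact h1
  · refine le_trans ?_ hκ
    change (Set.range _).ncard ≤ _
    rw [← Set.image_univ]
    exact (Set.ncard_image_le (Set.toFinite _)).trans (Set.ncard_univ _).le
  · exact (Set.ncard_insert_le _ _).trans (by rw [Set.ncard_singleton]; omega)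
  · exact h1

theorem twistHom_coe_eq_of_coe_eq {u v : CoprodI P} (h : (u : CoprodI P ⧸ K) = v)
    (x : CoprodI N) :
    ((x * twistHom p q g t u : CoprodI N) : CoprodI N ⧸ K.map (twistHom p q g t)) =
      ((x * twistHom p q g t v : CoprodI N) : CoprodI N ⧸ K.map (twistHom p q g t)) := by
  rw [QuotientGroup.eq] at h ⊢
  refine ⟨_, h, ?_⟩
  simp only [map_mul, map_inv]
  group

theorem finite_marks [Finite κ] {V : Set (CoprodI P ⧸ K)} (hV : V.Finite) :
    (marks p q g t K V).Finite := by
  have hfin : ∀ (α : Option κ) (i : Bool), ((fun (y : N i × (CoprodI P ⧸ K)) =>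
      ((((CoprodI.of y.1 * (twist p q g t α)⁻¹ * twistHom p q g t y.2.out : CoprodI N) :
        CoprodI N ⧸ K.map (twistHom p q g t))), i)) '' (markSet p q g t α i ×ˢ V)).Finite :=
    fun α i => ((finite_markSet p q g t α i).prod hV).image _
  refine (Set.finite_iUnion fun α => Set.finite_iUnion fun i => hfin α i).subset ?_
  rintro ⟨y, i⟩ ⟨u, hu, α, c, hc, hy⟩
  refine Set.mem_iUnion.2 ⟨α, Set.mem_iUnion.2 ⟨i, (c, (u : CoprodI P ⧸ K)), ⟨hc, hu⟩, ?_⟩⟩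
  exact Prod.ext ((twistHom_coe_eq_of_coe_eq p q g t (QuotientGroup.out_eq' _) _).trans hy.symm) rfl

theorem ePath_twist_conj {V : Set (CoprodI P ⧸ K)} {α : Option κ} {b : P α} {u : CoprodI P}
    (hu : (u : CoprodI P ⧸ K) ∈ V) (hbu : ((CoprodI.of b * u : CoprodI P) : CoprodI P ⧸ K) ∈ V) :
    EPath (fun i => (CoprodI.of : N i →* CoprodI N)) (marks p q g t K V)
      ((twistHom p q g t u : CoprodI N) : CoprodI N ⧸ K.map (twistHom p q g t))
      (twistHom p q g t (CoprodI.of b)) := by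
  rcases α with _ | a
  · have := EPath.step (j := fun i => (CoprodI.of : N i →* CoprodI N)) (E := marks p q g t K V)
      (z := ((twistHom p q g t u : CoprodI N) : CoprodI N ⧸ K.map (twistHom p q g t)))
      (i := false) (q b) .one ?_ ?_
    · simpa [twistHom_of, twist, sideInclusion, sideHom] using this
    · exact ⟨u, hu, none, 1, one_mem_markSet .., by simp [twist]⟩
    · refine ⟨_, hbu, none, 1, one_mem_markSet .., ?_⟩
      simp [twist, twistHom_of, sideInclusion, sideHom]
  · set x : N true := p (CoprodI.of (M := fun a => P (some a)) (g a)) with hx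
    have htw : twist p q g t (some a) = CoprodI.of x * CoprodI.of (q t) := rfl
    have hxm : x⁻¹ ∈ markSet p q g t none true := ⟨some a, rfl⟩
    have htm : q t ∈ markSet p q g t (some a) false := Or.inr rfl
    have hb : twistHom p q g t (CoprodI.of b) = CoprodI.of x * (CoprodI.of (q t) *
        (CoprodI.of (sideHom p q (some a) b) * (CoprodI.of (q t)⁻¹ *
          (CoprodI.of x⁻¹ * (1 : CoprodI N))))) := by
      rw [twistHom_of, htw, map_inv, map_inv]
      simp only [sideInclusion, MonoidHom.comp_apply]
      group
    have hbu' : twistHom p q g t (CoprodI.of b * u) = CoprodI.of x * (CoprodI.of (q t) *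
        (CoprodI.of (sideHom p q (some a) b) * (CoprodI.of (q t)⁻¹ *
          (CoprodI.of x⁻¹ * twistHom p q g t u)))) := by
      rw [map_mul, hb]; group
    rw [hb]
    refine .step (i := true) x (.step (i := false) (q t) (.step (i := true) _
      (.step (i := false) (q t)⁻¹ (.step (i := true) x⁻¹ .one ?_ ?_) ?_ ?_) ?_ ?_) ?_ ?_) ?_ ?_
    · exact ⟨u, hu, none, 1, one_mem_markSet .., by simp [twist]⟩
    · exact ⟨u, hu, none, x⁻¹, hxm, by simp [twist]⟩
    · exact ⟨u, hu, some a, q t, htm, by simp [htw]⟩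
    · exact ⟨u, hu, some a, 1, one_mem_markSet .., by simp [htw, mul_assoc]⟩
    · exact ⟨u, hu, some a, 1, one_mem_markSet .., by simp [htw, mul_assoc]⟩
    · exact ⟨_, hbu, some a, 1, one_mem_markSet .., by rw [hbu']; simp [htw, mul_assoc]⟩
    · exact ⟨_, hbu, some a, 1, one_mem_markSet .., by rw [hbu']; simp [htw, mul_assoc]⟩
    · exact ⟨_, hbu, some a, q t, htm, by rw [hbu']; simp [htw, mul_assoc]⟩
    · exact ⟨_, hbu, none, x⁻¹, hxm, by rw [hbu']; simp [twist, mul_assoc]⟩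
    · exact ⟨_, hbu, none, 1, one_mem_markSet .., by rw [hbu']; simp [twist, mul_assoc]⟩

theorem ePath_twistHom {E : Set ((CoprodI P ⧸ K) × Option κ)} {V : Set (CoprodI P ⧸ K)}
    (hEV : ∀ y ∈ E, y.1 ∈ V) {u : CoprodI P}
    (h : EPath (fun α => (CoprodI.of : P α →* CoprodI P)) E ((1 : CoprodI P) : CoprodI P ⧸ K) u) :
    EPath (fun i => (CoprodI.of : N i →* CoprodI N)) (marks p q g t K V)
      ((1 : CoprodI N) : CoprodI N ⧸ K.map (twistHom p q g t)) (twistHom p q g t u) := by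
  induction h with
  | one => rw [map_one]; exact .one
  | @step α b u _ h1 h2 ih =>
    rw [map_mul]
    refine ih.trans ?_
    have := ePath_twist_conj p q g t (K := K) (V := V) (u := u) (b := b)
      (by simpa using hEV _ h1) (by simpa using hEV _ h2)
    simpa using this

variable {g t}

theorem eq_of_smul_marks_eq (hg : ∀ a, g a ≠ 1) (ht : t ≠ 1) {α β : Option κ} {u u' : CoprodI P}
    {i : Bool} {m : N i}
    (h : (CoprodI.of m : CoprodI N) • (((twist p q g t α)⁻¹ * twistHom p q g t u : CoprodI N) :
        CoprodI N ⧸ K.map (twistHom p q g t)) =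
      (((twist p q g t β)⁻¹ * twistHom p q g t u' : CoprodI N) :
        CoprodI N ⧸ K.map (twistHom p q g t))) :
    ∃ b : P α, α = β ∧ u'⁻¹ * CoprodI.of b * u ∈ K ∧ CoprodI.of m = sideInclusion p q α b := by
  obtain ⟨k, hk, hkm⟩ := smul_quotient_eq_iff.1 h
  have hm : CoprodI.of m =
      (twist p q g t β)⁻¹ * twistHom p q g t (u' * k * u⁻¹) * twist p q g t α := by
    rw [map_mul, map_mul, hkm, map_inv]; group
  obtain ⟨rfl, b, hb⟩ := eq_of_twistHom_eq p q hg ht hm.symm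
  refine ⟨b, rfl, ?_, ?_⟩
  · rw [← hb]
    have : u'⁻¹ * (u' * k * u⁻¹) * u = k := by group
    rwa [this]
  · rw [hm, hb, twistHom_of]; group

theorem ncard_marks_le (hg : ∀ a, g a ≠ 1) (ht : t ≠ 1) [Finite κ] [∀ α, Finite (P α)] {d : ℕ}
    (hd : 2 ≤ d) (hκ : Nat.card (Option κ) ≤ d) (hP : ∀ α, Nat.card (P α) ≤ d)
    (V : Set (CoprodI P ⧸ K)) (i : Bool) (r : CoprodI N ⧸ K.map (twistHom p q g t)) :
    {y | (y, i) ∈ marks p q g t K V ∧ orbitRep (G := N) i y = r}.ncard ≤ d := by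
  rcases Set.eq_empty_or_nonempty
    {y | (y, i) ∈ marks p q g t K V ∧ orbitRep (G := N) i y = r} with h | ⟨y₀, ⟨h₀, hr₀⟩⟩
  · rw [h, Set.ncard_empty]; exact Nat.zero_le d
  obtain ⟨u₀, -, α, c₀, -, hy₀⟩ := h₀
  have key : ∀ y, (y, i) ∈ marks p q g t K V → orbitRep (G := N) i y = r →
      ∃ c ∈ markSet p q g t α i, ∃ b : P α, (∃ m : N i, CoprodI.of m = sideInclusion p q α b) ∧
        y = ((CoprodI.of c * (twist p q g t α)⁻¹ * twistHom p q g t (CoprodI.of b * u₀) :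
          CoprodI N) : CoprodI N ⧸ K.map (twistHom p q g t)) := by
    rintro y ⟨u, -, β, c, hc, hy⟩ hr
    obtain ⟨n₀, hn₀⟩ := exists_smul_orbitRep (G := N) i y₀
    obtain ⟨n, hn⟩ := exists_smul_orbitRep (G := N) i y
    dsimp only at hy hy₀
    have hm : (CoprodI.of (c⁻¹ * n * n₀⁻¹ * c₀) : CoprodI N) •
        (((twist p q g t α)⁻¹ * twistHom p q g t u₀ : CoprodI N) :
          CoprodI N ⧸ K.map (twistHom p q g t)) =
        (((twist p q g t β)⁻¹ * twistHom p q g t u : CoprodI N) :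
          CoprodI N ⧸ K.map (twistHom p q g t)) := by
      rw [mul_assoc, ← smul_eq_mul, ← MulAction.Quotient.smul_coe] at hy hy₀
      rw [map_mul, map_mul, map_mul, mul_smul, ← hy₀, mul_smul, mul_smul, ← hn₀, map_inv, map_inv,
        inv_smul_smul, hr₀, ← hr, hn, hy, inv_smul_smul]
    obtain ⟨b, rfl, hb, hbm⟩ := eq_of_smul_marks_eq p q hg ht hm
    refine ⟨c, hc, b, ⟨_, hbm⟩, ?_⟩
    rw [hy]
    exact twistHom_coe_eq_of_coe_eq p q g t (by rw [QuotientGroup.eq, ← mul_assoc]; exact hb) _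
  by_cases hi : α.isSome = i
  · subst hi
    refine le_trans ?_ (hP α)
    rw [← Set.ncard_univ]
    refine (Set.ncard_le_ncard (t := (fun b : P α =>
      (((twist p q g t α)⁻¹ * twistHom p q g t (CoprodI.of b * u₀) : CoprodI N) :
        CoprodI N ⧸ K.map (twistHom p q g t))) '' Set.univ) ?_
      (Set.toFinite _)).trans (Set.ncard_image_le Set.finite_univ)
    rintro y ⟨hy, hr⟩
    obtain ⟨c, hc, b, -, rfl⟩ := key y hy hr
    rw [markSet_isSome] at hc
    obtain rfl := hc
    exact ⟨b, trivial, by simp⟩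
  · refine le_trans ?_ (ncard_markSet_le p q g t hd hκ α i)
    refine (Set.ncard_le_ncard (t := (fun c : N i =>
      ((CoprodI.of c * (twist p q g t α)⁻¹ * twistHom p q g t u₀ : CoprodI N) :
        CoprodI N ⧸ K.map (twistHom p q g t))) '' markSet p q g t α i) ?_
      ((finite_markSet p q g t α i).image _)).trans
        (Set.ncard_image_le (finite_markSet p q g t α i))
    rintro y ⟨hy, hr⟩
    obtain ⟨c, hc, b, ⟨m, hm⟩, rfl⟩ := key y hy hr
    have hb : b = 1 := sideHom_injective p q α
      ((eq_one_of_of_eq_of (Ne.symm hi) hm).trans (map_one _).symm)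
    exact ⟨c, hc, by simp [hb]⟩

theorem eq_one_of_conj_mem_map (hg : ∀ a, g a ≠ 1) (ht : t ≠ 1) (hK : FactorFreeI K) {i : Bool}
    {a : N i} {w : CoprodI.Word N} (hw : ∀ x ∈ w.toList.head?, i ≠ x.1)
    (ha : w.prod⁻¹ * CoprodI.of a * w.prod ∈ K.map (twistHom p q g t)) : a = 1 := by
  by_contra ha1
  obtain ⟨k, -, hk⟩ := id ha
  obtain ⟨E, -, hE⟩ := (isFreeProd_coprodI P).exists_finite_ePath
    ((1 : CoprodI P) : CoprodI P ⧸ K) k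
  have hS := ePath_twistHom p q g t (V := Set.univ) (fun y _ => trivial) hE
  have hl : ∃ (v : CoprodI.Word N) (l : List (Σ i, N i)), v.prod = twistHom p q g t k ∧
      v.toList = l ++ ⟨i, a⟩ :: w.toList := by
    rw [hk]
    by_cases hw1 : w = CoprodI.Word.empty
    · subst hw1
      exact ⟨(CoprodI.NeWord.singleton a ha1).toWord, [], by
        change (CoprodI.NeWord.singleton a ha1).prod = _; simp, by
        change (CoprodI.NeWord.singleton a ha1).toList = _; simp⟩
    · obtain ⟨j, l, w', rfl⟩ := CoprodI.NeWord.of_word w hw1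
      have hij : i ≠ j := hw ⟨j, w'.head⟩ (by
        change _ ∈ w'.toList.head?
        rw [CoprodI.NeWord.toList_head?]; rfl)
      refine ⟨(CoprodI.NeWord.append (CoprodI.NeWord.append w'.inv hij.symm
        (CoprodI.NeWord.singleton a ha1)) hij w').toWord, w'.inv.toList, ?_, ?_⟩
      · change (CoprodI.NeWord.append _ hij w').prod = w'.prod⁻¹ * _ * w'.prod
        simp
      · change (CoprodI.NeWord.append _ hij w').toList = _ ++ _ :: w'.toList
        simp [CoprodI.NeWord.toList]
  obtain ⟨v, l, hv, hvl⟩ := hl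
  rw [← hv] at hS
  have hmem := hS.suffixesIn
  rw [hvl] at hmem
  obtain ⟨u, -, α, c, -, hu⟩ := hmem.mem_of_eq_append.1
  dsimp only at hu
  rw [letterProd_toList, mul_assoc, ← smul_eq_mul (CoprodI.of c), ← MulAction.Quotient.smul_coe,
    ← inv_smul_eq_iff] at hu
  have hfix : (CoprodI.of a : CoprodI N) • w.prod •
      ((1 : CoprodI N) : CoprodI N ⧸ K.map (twistHom p q g t)) =
        w.prod • ((1 : CoprodI N) : CoprodI N ⧸ K.map (twistHom p q g t)) := by
    rw [← inv_smul_eq_iff, ← mul_smul, ← mul_smul, smul_quotient_eq_iff]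
    simpa using ha
  have hm : (CoprodI.of (c⁻¹ * a * c) : CoprodI N) •
      (((twist p q g t α)⁻¹ * twistHom p q g t u : CoprodI N) :
        CoprodI N ⧸ K.map (twistHom p q g t)) =
      (((twist p q g t α)⁻¹ * twistHom p q g t u : CoprodI N) :
        CoprodI N ⧸ K.map (twistHom p q g t)) := by
    rw [← hu, map_mul, map_mul, map_inv, mul_smul, mul_smul, smul_inv_smul, hfix]
  obtain ⟨b, -, hb, hbm⟩ := eq_of_smul_marks_eq p q hg ht hm
  have hb1 : b = 1 := factorFreeI_iff.1 hK u α b hb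
  rw [hb1, map_one, ← map_one CoprodI.of] at hbm
  have := CoprodI.of_injective _ hbm
  exact ha1 (by simpa using conj_eq_one_iff.1 (by simpa using this : c⁻¹ * a * c⁻¹⁻¹ = 1))

/-- The embedding `twistHom` maps factor-free subgroups to factor-free subgroups. -/
theorem FactorFreeI.map_twistHom (hg : ∀ a, g a ≠ 1) (ht : t ≠ 1) (hK : FactorFreeI K) :
    FactorFreeI (K.map (twistHom p q g t)) := by
  classical
  rw [factorFreeI_iff]
  intro s i a ha
  obtain ⟨w, rfl⟩ := (CoprodI.Word.equiv (M := N)).symm.surjective s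
  change w.prod⁻¹ * _ * w.prod ∈ _ at ha
  by_cases hw : ∀ x ∈ w.toList.head?, i ≠ x.1
  · exact eq_one_of_conj_mem_map p q hg ht hK hw ha
  obtain ⟨l, hne, hch⟩ := w
  rcases l with _ | ⟨⟨k, m⟩, l⟩
  · simp at hw
  obtain rfl : i = k := by simpa using hw
  have hc := List.isChain_cons.1 hch
  have := eq_one_of_conj_mem_map p q hg ht hK (i := i) (a := m⁻¹ * a * m)
    (w := ⟨l, fun x hx => hne x (List.mem_cons_of_mem _ hx), hc.2⟩) hc.1 ?_
  · simpa using conj_eq_one_iff.1 (by simpa using this : m⁻¹ * a * m⁻¹⁻¹ = 1)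
  · have e : (CoprodI.Word.mk (⟨i, m⟩ :: l) hne hch).prod = CoprodI.of m *
        (CoprodI.Word.mk l (fun x hx => hne x (List.mem_cons_of_mem _ hx)) hc.2).prod := by
      simp [CoprodI.Word.prod]
    rw [e] at ha
    convert ha using 1
    rw [map_mul, map_mul, map_inv]
    group

/-- The embedding `twistHom` maps finitely generated factor-free noncyclic subgroups to subgroups
with irreducible core graphs of degree bounded in terms of the factors. -/
theorem memKff_map_twistHom (hg : ∀ a, g a ≠ 1) (ht : t ≠ 1) [Finite κ] [∀ α, Finite (P α)]
    {d : ℕ} (hd : 2 ≤ d) (hκ : Nat.card (Option κ) ≤ d) (hP : ∀ α, Nat.card (P α) ≤ d)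
    (hfg : K.FG) (hK : FactorFreeI K) (hnc : Noncyclic K) :
    memKff (K.map (twistHom p q g t)) d := by
  have hinj := twistHom_injective p q hg ht
  have hnc' : Noncyclic (K.map (twistHom p q g t)) := hnc.map hinj
  have hff := hK.map_twistHom p q hg ht
  refine ⟨(fg_map_iff hinj).2 hfg, hff, hnc', ?_⟩
  obtain ⟨E, hE, hp⟩ := (isFreeProd_coprodI P).exists_finite_ePath_of_fg
    (z := ((1 : CoprodI P) : CoprodI P ⧸ K)) hfg (fun h hh => by
      rw [smul_quotient_eq_iff]; simpa using hh)
  refine exists_isIrrCoreGraphOf (o := ((1 : CoprodI N) : CoprodI N ⧸ K.map (twistHom p q g t)))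
    hff.factorsActFreely (fun w => by rw [smul_quotient_eq_iff]; simp)
    (fun h => hnc' 1 (by rw [h]; exact Subgroup.closure_singleton_one.symm))
    (finite_marks p q g t (hE.image Prod.fst)) ?_
    (by simpa using hd) (fun i r => ncard_marks_le p q hg ht hd hκ hP _ i r)
  rintro _ ⟨k, hk, rfl⟩
  exact ePath_twistHom p q g t (fun y hy => Set.mem_image_of_mem Prod.fst hy) (hp k hk)

end Marks

section SubFactors

variable {I Λ : Type} {G : I → Type} [∀ i, Group (G i)] {e : Λ → I}

/-- The natural homomorphism to a free product from the free product of some of its factors. -/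
def subFactors (G : I → Type) [∀ i, Group (G i)] (e : Λ → I) :
    CoprodI (fun a => G (e a)) →* CoprodI G :=
  CoprodI.lift fun a => (CoprodI.of : G (e a) →* CoprodI G)

theorem subFactors_of (a : Λ) (b : G (e a)) :
    subFactors G e (CoprodI.of (M := fun a => G (e a)) b) = CoprodI.of b := by
  simp [subFactors]

theorem exists_retraction_subFactors (he : Function.Injective e) :
    ∃ r : CoprodI G →* CoprodI (fun a => G (e a)),
      (∀ a (b : G (e a)), r (CoprodI.of b) = CoprodI.of (M := fun a => G (e a)) b) ∧
      ∀ i, i ∉ Set.range e → ∀ b : G i, r (CoprodI.of b) = 1 := by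
  classical
  let f : ∀ i, G i →* CoprodI (fun a => G (e a)) := fun i =>
    if h : ∃ a, e a = i then
      h.choose_spec ▸ (CoprodI.of (M := fun a => G (e a)) (i := h.choose)) else 1
  refine ⟨CoprodI.lift f, fun a b => ?_, fun i hi b => ?_⟩
  · rw [CoprodI.lift_of]
    have h : ∃ a', e a' = e a := ⟨a, rfl⟩
    have key : ∀ a' (h' : e a' = e a),
        (h' ▸ (CoprodI.of (M := fun a => G (e a)) (i := a')) :
          G (e a) →* CoprodI (fun a => G (e a))) b = CoprodI.of (M := fun a => G (e a)) b := by
      intro a' h'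
      obtain rfl := he h'
      rfl
    simp only [f, dif_pos h]
    exact key _ h.choose_spec
  · rw [CoprodI.lift_of]
    simp only [f]
    rw [dif_neg (show ¬ ∃ a, e a = i from hi)]
    rfl

theorem subFactors_injective (he : Function.Injective e) :
    Function.Injective (subFactors G e) := by
  obtain ⟨r, hr, -⟩ := exists_retraction_subFactors (G := G) he
  have : r.comp (subFactors G e) = MonoidHom.id _ := by
    ext a b
    simp [subFactors_of, hr]
  exact Function.LeftInverse.injective (g := r) fun u => DFunLike.congr_fun this u

theorem cocyclesExtend_subFactors (he : Function.Injective e) :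
    CocyclesExtend (subFactors G e) := by
  intro Y _ C hC
  obtain ⟨r, hr, hr1⟩ := exists_retraction_subFactors (G := G) he
  have hC1 : ∀ y, C 1 y = 1 := fun y => by simpa using hC 1 1 y
  obtain ⟨C', hC', hCC⟩ := (isFreeProd_coprodI G).exists_isCocycle (X := Y)
    (fun i b y => C (r (CoprodI.of b)) y) (by
      intro i b b' y
      by_cases hi : i ∈ Set.range e
      · obtain ⟨a, rfl⟩ := hi
        rw [map_mul, map_mul, hC, hr, hr, subFactors_of]
      · simp [hr1 i hi, hC1])
  refine ⟨C', hC', fun u => ?_⟩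
  induction u using CoprodI.induction_on with
  | one => intro y; rw [map_one, hC'.one, hC1]
  | of a b => intro y; rw [subFactors_of, hCC, hr]
  | mul x y hx hy => intro z; rw [map_mul, hC', hC, hx, hy]

theorem FactorFreeI.comap_subFactors {H : Subgroup (CoprodI G)} (h : FactorFreeI H)
    (s : CoprodI G) : FactorFreeI ((conjS s H).comap (subFactors G e)) := by
  rw [factorFreeI_iff] at h ⊢
  intro x a b hb
  rw [Subgroup.mem_comap, mem_conjS, map_mul, map_mul, subFactors_of, map_inv] at hb
  refine h (subFactors G e x * s) (e a) b ?_
  convert hb using 1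
  group

theorem exists_finset_le_range_subFactors {H : Subgroup (CoprodI G)} (h : H.FG) :
    ∃ T : Finset I, ∀ (Λ : Type) (e : Λ → I), (∀ i ∈ T, i ∈ Set.range e) →
      H ≤ (subFactors G e).range := by
  classical
  have key : ∀ u : CoprodI G, ∃ T : Finset I, ∀ (Λ : Type) (e : Λ → I),
      (∀ i ∈ T, i ∈ Set.range e) → u ∈ (subFactors G e).range := by
    intro u
    induction u using CoprodI.induction_on with
    | one => exact ⟨∅, fun _ _ _ => one_mem _⟩
    | of i b =>
      refine ⟨{i}, fun Λ e he => ?_⟩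
      obtain ⟨a, rfl⟩ := he i (by simp)
      exact ⟨_, subFactors_of a b⟩
    | mul x y hx hy =>
      obtain ⟨T, hT⟩ := hx
      obtain ⟨T', hT'⟩ := hy
      exact ⟨T ∪ T', fun Λ e he => mul_mem (hT Λ e fun i hi => he i (by simp [hi]))
        (hT' Λ e fun i hi => he i (by simp [hi]))⟩
  choose T hT using key
  obtain ⟨S, rfl⟩ := h
  refine ⟨S.biUnion T, fun Λ e he => (Subgroup.closure_le _).2 fun u hu => ?_⟩
  exact hT u Λ e fun i hi => he i (Finset.mem_biUnion.2 ⟨u, hu, hi⟩)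

end SubFactors

section Intersections

variable {F : Type} [Group F]

theorem rrk_conjS (t : F) (H : Subgroup F) : rrk (conjS t H) = rrk H := by
  rw [rrk, rrk, rk_conjS]

theorem rrk_inf_conjS_congr {H K : Subgroup F} {s t : F} (h : dcSetoid H K s t) :
    rrk (H ⊓ conjS s K) = rrk (H ⊓ conjS t K) := by
  obtain ⟨x, hx, k, hk, rfl⟩ := h
  rw [← rrk_conjS x (H ⊓ conjS s K)]
  congr 1
  ext y
  simp only [mem_conjS, Subgroup.mem_inf]
  have e : (x * s * k)⁻¹ * y * (x * s * k) = k⁻¹ * (s⁻¹ * (x⁻¹ * y * x) * s) * k := by group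
  rw [e, K.mul_mem_cancel_right hk, K.mul_mem_cancel_left (K.inv_mem hk),
    H.mul_mem_cancel_right hx, H.mul_mem_cancel_left (H.inv_mem hx)]

theorem sum_rrk_le_rrkInter_map {F' : Type} [Group F'] {φ : F' →* F} (hφ : Function.Injective φ)
    {H K : Subgroup F'}
    (hfin : (Function.support fun q : Quotient (dcSetoid (H.map φ) (K.map φ)) =>
      rrk (H.map φ ⊓ conjS q.out (K.map φ))).Finite)
    {J : Type} [Fintype J] (s : J → F') (hs : ∀ a b, dcSetoid H K (s a) (s b) → a = b) :
    ∑ a, rrk (H ⊓ conjS (s a) K) ≤ rrkInter (H.map φ) (K.map φ) := by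
  classical
  let m : J → Quotient (dcSetoid (H.map φ) (K.map φ)) := fun a => Quotient.mk _ (φ (s a))
  have hm : Function.Injective m := by
    intro a b hab
    obtain ⟨_, ⟨h, hh, rfl⟩, _, ⟨k, hk, rfl⟩, e⟩ := Quotient.exact hab
    exact hs a b ⟨h, hh, k, hk, hφ (by simpa using e)⟩
  have hterm : ∀ a, rrk (H ⊓ conjS (s a) K) = rrk (H.map φ ⊓ conjS (m a).out (K.map φ)) := by
    intro a
    rw [rrk_inf_conjS_congr (Quotient.mk_out (s := dcSetoid (H.map φ) (K.map φ)) (φ (s a))),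
      rrk, rrk, ← rk_map hφ]
    congr 2
    ext y
    simp only [Subgroup.mem_map, Subgroup.mem_inf, mem_conjS]
    constructor
    · rintro ⟨x, ⟨hx, hx'⟩, rfl⟩
      exact ⟨⟨x, hx, rfl⟩, _, hx', by simp⟩
    · rintro ⟨⟨x, hx, rfl⟩, z, hz, e⟩
      refine ⟨x, ⟨hx, ?_⟩, rfl⟩
      have : z = (s a)⁻¹ * x * s a := hφ (by simpa using e)
      rwa [← this]
  rw [rrkInter, finsum_eq_sum_of_support_subset (s := hfin.toFinset ∪ Finset.univ.image m) _
    (by intro q hq; simp only [Finset.coe_union, Set.Finite.coe_toFinset]; exact Or.inl hq)]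
  calc ∑ a, rrk (H ⊓ conjS (s a) K)
      = ∑ q ∈ Finset.univ.image m, rrk (H.map φ ⊓ conjS q.out (K.map φ)) := by
        rw [Finset.sum_image (fun a _ b _ h => hm h)]
        exact Finset.sum_congr rfl fun a _ => hterm a
    _ ≤ _ := Finset.sum_le_sum_of_subset Finset.subset_union_right

theorem exists_finite_support_and_rrkInter_le {ι : Type} {G : ι → Type} [∀ i, Group (G i)]
    [∀ i, Finite (G i)] {j : ∀ i, G i →* F} (hF : IsFreeProd G F j) {H1 : Subgroup F}
    (h1 : H1.FG) (hfree : IsFreeGroup H1) :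
    ∃ N : ℕ, ∀ H2 : Subgroup F, H2.FG →
      (Function.support fun q : Quotient (dcSetoid H1 H2) => rrk (H1 ⊓ conjS q.out H2)).Finite ∧
        rrkInter H1 H2 ≤ N * rk H2 := by
  obtain ⟨N, hN⟩ := exists_sum_rk_inf_conjS_le hF h1 hfree
  refine ⟨N, fun H2 h2 => ?_⟩
  have hsum : ∀ T : Finset (Quotient (dcSetoid H1 H2)),
      ∑ q ∈ T, rrk (H1 ⊓ conjS q.out H2) ≤ N * rk H2 := by
    intro T
    rw [← Finset.sum_coe_sort]
    refine le_trans (Finset.sum_le_sum fun q _ => Nat.sub_le _ _)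
      (hN H2 h2 T (fun q => q.1.out) fun a b hab => Subtype.ext ?_).2
    exact Quotient.out_equiv_out.1 hab
  have hfin : (Function.support fun q : Quotient (dcSetoid H1 H2) =>
      rrk (H1 ⊓ conjS q.out H2)).Finite := by
    by_contra hinf
    obtain ⟨T, hT, hcard⟩ := Set.Infinite.exists_subset_card_eq hinf (N * rk H2 + 1)
    have := Finset.card_nsmul_le_sum T (fun q => rrk (H1 ⊓ conjS q.out H2)) 1
      fun q hq => Nat.one_le_iff_ne_zero.2 (hT hq)
    have := hsum T
    simp only [smul_eq_mul, mul_one] at *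
    omega
  exact ⟨hfin, by rw [rrkInter, finsum_eq_sum _ hfin]; exact hsum _⟩

theorem Noncyclic.one_le_rrk {H : Subgroup F} (h : Noncyclic H) (hf : H.FG) : 1 ≤ rrk H := by
  have := h.two_le_rk hf
  rw [rrk]; omega

theorem rrkInter_map_le {F' : Type} [Group F'] {φ : F' →* F} (hφ : Function.Injective φ)
    (hext : CocyclesExtend φ) {H : Subgroup F'} {H2 : Subgroup F} (h2 : H2.FG)
    (hfree : IsFreeGroup H2) {c : ℝ} (hc : 0 ≤ c)
    (hH : ∀ g, ((conjS g H2).comap φ).FG → ∀ (J : Type) [Fintype J] (s : J → F'),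
      (∀ a b, dcSetoid H ((conjS g H2).comap φ) (s a) (s b) → a = b) →
        ∑ a, (rrk (H ⊓ conjS (s a) ((conjS g H2).comap φ)) : ℝ) ≤
          c * rrk ((conjS g H2).comap φ)) :
    (rrkInter (H.map φ) H2 : ℝ) ≤ c * rrk H2 := by
  classical
  by_cases hfin : (Function.support fun q : Quotient (dcSetoid (H.map φ) H2) =>
    rrk (H.map φ ⊓ conjS q.out H2)).Finite
  swap
  · rw [rrkInter, finsum_of_infinite_support hfin]
    simpa using mul_nonneg hc (Nat.cast_nonneg _)
  let T := hfin.toFinset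
  let m : T → Quotient (dcSetoid φ.range H2) := fun q => Quotient.mk _ q.1.out
  let J := ↥(Finset.univ.image m)
  let mJ : T → J := fun q => ⟨m q, Finset.mem_image_of_mem _ (Finset.mem_univ _)⟩
  have hm : ∀ q : T, ∃ (u : F') (k : F), k ∈ H2 ∧ φ u * (mJ q).1.out * k = q.1.out := by
    intro q
    obtain ⟨_, ⟨u, rfl⟩, k, hk, e⟩ := Quotient.mk_out (s := dcSetoid φ.range H2) q.1.out
    exact ⟨u, k, hk, e⟩
  choose u k hk hu using hm
  let K : J → Subgroup F' := fun a => (conjS a.1.out H2).comap φ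
  have hB := fg_and_sum_rk_comap_le hφ hext h2 hfree (fun a : J => a.1.out)
    fun a b hab => Subtype.ext (Quotient.out_equiv_out.1 hab)
  have hterm : ∀ q : T, rrk (H.map φ ⊓ conjS q.1.out H2) =
      rrk (H ⊓ conjS (u q) (K (mJ q))) := by
    intro q
    rw [rrk, rrk, ← rk_map hφ]
    congr 2
    have e : ∀ y : F, (q.1.out)⁻¹ * y * q.1.out ∈ H2 ↔
        (mJ q).1.out⁻¹ * ((φ (u q))⁻¹ * y * φ (u q)) * (mJ q).1.out ∈ H2 := by
      intro y
      have e' : (q.1.out)⁻¹ * y * q.1.out = (k q)⁻¹ *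
          ((mJ q).1.out⁻¹ * ((φ (u q))⁻¹ * y * φ (u q)) * (mJ q).1.out) * k q := by
        rw [← hu q]; group
      rw [e', H2.mul_mem_cancel_right (hk q), H2.mul_mem_cancel_left (H2.inv_mem (hk q))]
    ext y
    simp only [Subgroup.mem_map, Subgroup.mem_inf, mem_conjS, K, Subgroup.mem_comap, e]
    constructor
    · rintro ⟨⟨x, hx, rfl⟩, hy⟩
      exact ⟨x, ⟨hx, by simpa using hy⟩, rfl⟩
    · rintro ⟨x, ⟨hx, hx'⟩, rfl⟩
      exact ⟨⟨x, hx, rfl⟩, by simpa using hx'⟩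
  have hfiber : ∀ a : J, ∑ q : {q : T // mJ q = a}, (rrk (H ⊓ conjS (u q.1) (K (mJ q.1))) : ℝ) ≤
      c * rrk (K a) := by
    intro a
    have := hH a.1.out (hB.1 a) {q : T // mJ q = a} (fun q => u q.1) ?_
    · refine le_trans (Finset.sum_le_sum fun q _ => ?_) this
      rw [q.2]
    · rintro ⟨q, rfl⟩ ⟨q', hq'⟩ ⟨h, hh, x, hx, e⟩
      refine Subtype.ext (Subtype.ext (Quotient.out_equiv_out.1 ?_))
      rw [Subgroup.mem_comap, mem_conjS] at hx
      dsimp only at e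
      refine ⟨φ h, ⟨h, hh, rfl⟩, (k q)⁻¹ * ((mJ q).1.out⁻¹ * φ x * (mJ q).1.out) * k q',
        H2.mul_mem (H2.mul_mem (H2.inv_mem (hk q)) hx) (hk q'), ?_⟩
      rw [← hu q', hq', ← e, ← hu q, map_mul, map_mul]
      group
  have hsum : (rrkInter (H.map φ) H2 : ℝ) =
      ∑ a : J, ∑ q : {q : T // mJ q = a}, (rrk (H ⊓ conjS (u q.1) (K (mJ q.1))) : ℝ) := by
    rw [Fintype.sum_fiberwise mJ fun q => (rrk (H ⊓ conjS (u q) (K (mJ q))) : ℝ), rrkInter,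
      finsum_eq_sum _ hfin, ← Finset.sum_coe_sort, Nat.cast_sum]
    exact Finset.sum_congr rfl fun q _ => congrArg _ (hterm q)
  rw [hsum]
  refine (Finset.sum_le_sum fun a _ => hfiber a).trans ?_
  rw [← Finset.mul_sum]
  refine mul_le_mul_of_nonneg_left ?_ hc
  exact_mod_cast sum_rrk_le K hB.2

end Intersections

section Assembly

theorem Noncyclic.mono {F : Type} [Group F] {H K : Subgroup F} (h : Noncyclic H) (hHK : H ≤ K) :
    Noncyclic K := by
  rintro g rfl
  rw [← Subgroup.zpowers_eq_closure] at hHK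
  have : IsCyclic H := Subgroup.isCyclic_of_le hHK
  obtain ⟨x, hx⟩ := (Subgroup.isCyclic_iff_exists_zpowers_eq_top H).1 this
  exact h x (by rw [← hx, Subgroup.zpowers_eq_closure])

theorem exists_mulEquiv_coprodI_singleton {I : Type} {G : I → Type} [∀ i, Group (G i)] (β : I) :
    Nonempty (G β ≃* CoprodI fun α : ({β} : Finset I) => G α.1) := by
  refine ⟨MulEquiv.ofBijective (CoprodI.of (M := fun α : ({β} : Finset I) => G α.1)
    (i := ⟨β, Finset.mem_singleton_self β⟩)) ⟨CoprodI.of_injective _, fun u => ?_⟩⟩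
  induction u using CoprodI.induction_on with
  | one => exact ⟨1, map_one _⟩
  | of i b =>
    obtain ⟨i, hi⟩ := i
    obtain rfl := Finset.mem_singleton.1 hi
    exact ⟨b, rfl⟩
  | mul x y hx hy =>
    obtain ⟨a, rfl⟩ := hx
    obtain ⟨b, rfl⟩ := hy
    exact ⟨a * b, map_mul _ _ _⟩

variable {κ : Type} {P : Option κ → Type} [∀ α, Group (P α)] {N : Bool → Type} [∀ i, Group (N i)]

theorem bddAbove_wnSetD (p : CoprodI (fun a : κ => P (some a)) ≃* N true) (q : P none ≃* N false)
    [∀ α, Finite (P α)] {H : Subgroup (CoprodI N)} (hfg : H.FG)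
    (hff : FactorFreeI H) (hnc : Noncyclic H) (d : ℕ) : BddAbove (wnSetD H d) := by
  obtain ⟨n, hn⟩ := exists_finite_support_and_rrkInter_le (isFreeProd_sideInclusion p q) hfg
    hff.isFreeGroup
  refine ⟨2 * n, ?_⟩
  rintro _ ⟨K, hK, rfl⟩
  have h1 := hnc.one_le_rrk hfg
  have h2 := hK.2.2.1.one_le_rrk hK.1
  have h3 : rk K ≤ 2 * rrk K := by rw [rrk] at h2 ⊢; omega
  have h4 : rrkInter H K ≤ 2 * n * (rrk H * rrk K) :=
    calc rrkInter H K ≤ n * rk K := (hn K hK.1).2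
      _ ≤ n * (2 * rrk K) := Nat.mul_le_mul_left _ h3
      _ = 2 * n * (1 * rrk K) := by ring
      _ ≤ 2 * n * (rrk H * rrk K) := by gcongr
  have h5 : 0 < rrk H * rrk K := Nat.mul_pos h1 h2
  rw [div_le_iff₀ (by exact_mod_cast h5)]
  exact_mod_cast h4

theorem sum_rrk_inf_le_of_map_twistHom
    (p : CoprodI (fun a : κ => P (some a)) ≃* N true) (q : P none ≃* N false) [Finite κ] [∀ α, Finite (P α)] {g : ∀ a, P (some a)}
    {t : P none} (hg : ∀ a, g a ≠ 1) (ht : t ≠ 1) {d : ℕ} (hd : 2 ≤ d)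
    (hκ : Nat.card (Option κ) ≤ d) (hP : ∀ α, Nat.card (P α) ≤ d) {H K : Subgroup (CoprodI P)}
    (hfg : H.FG) (hff : FactorFreeI H) (hnc : Noncyclic H) (hKfg : K.FG) (hKff : FactorFreeI K)
    {J : Type} [Fintype J] (s : J → CoprodI P) (hs : ∀ a b, dcSetoid H K (s a) (s b) → a = b) :
    ∑ a, (rrk (H ⊓ conjS (s a) K) : ℝ) ≤
      sSup (wnSetD (H.map (twistHom p q g t)) d) * rrk H * rrk K := by
  have hinj := twistHom_injective p q hg ht
  by_cases hK : Noncyclic K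
  · have hmem := memKff_map_twistHom p q hg ht hd hκ hP hKfg hKff hK
    have hHfg := (fg_map_iff hinj).2 hfg
    have hHff := hff.map_twistHom p q hg ht
    have hle := le_csSup (bddAbove_wnSetD p q hHfg hHff (hnc.map hinj) d) ⟨_, hmem, rfl⟩
    obtain ⟨n, hn⟩ := exists_finite_support_and_rrkInter_le (isFreeProd_sideInclusion p q) hHfg
      hHff.isFreeGroup
    have hsum := sum_rrk_le_rrkInter_map hinj (hn _ hmem.1).1 s hs
    have hr : ∀ L : Subgroup (CoprodI P), rrk (L.map (twistHom p q g t)) = rrk L := fun L => by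
      rw [rrk, rrk, rk_map hinj]
    have h5 : 0 < rrk H * rrk K := Nat.mul_pos (hnc.one_le_rrk hfg) (hK.one_le_rrk hKfg)
    rw [hr, hr, div_le_iff₀ (by exact_mod_cast h5), ← mul_assoc] at hle
    exact le_trans (by exact_mod_cast hsum) hle
  · have hK0 : ∀ a, rrk (H ⊓ conjS (s a) K) = 0 := fun a =>
      rrk_eq_zero_of_not_noncyclic fun h =>
        hK ((noncyclic_map_iff (MulAut.conj (s a)).injective).1 (h.mono inf_le_right))
    simp [hK0, rrk_eq_zero_of_not_noncyclic hK]

end Assembly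

/-- Theorem 1.3(a),(c): if `H1` is a finitely generated factor-free noncyclic
subgroup of `F = ∗_{α∈I} G_α`, then there are disjoint finite subsets `I1, I2 ⊆ I` and a
finitely generated noncyclic subgroup `Ĥ1` of `F̂ = Ĝ1 ∗ Ĝ2` (where `Ĝ1 = ∗_{α∈I1} G_α`,
`Ĝ2 = ∗_{α∈I2} G_α`), factor-free with respect to the two factors, with `r̄(Ĥ1) = r̄(H1)`,
such that if all `G_α`, `α ∈ I1 ∪ I2`, are finite then, with
`d_M = max(|I1 ∪ I2|, max_{α∈I1∪I2} |G_α|)`, one has `σ_{d_M}(Ĥ1) ≥ σ(H1)`. -/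
theorem statement5 {I : Type} [DecidableEq I] {G : I → Type} [∀ i, Group (G i)]
    [∀ i, Nontrivial (G i)]
    (H1 : Subgroup (Monoid.CoprodI G))
    (h1fg : H1.FG) (h1ff : FactorFreeI H1) (h1nc : Noncyclic H1) :
    ∃ (I1 I2 : Finset I), Disjoint I1 I2 ∧
      ∃ H1h : Subgroup (Monoid.CoprodI (famTwo
          (Monoid.CoprodI fun α : I1 => G α.1)
          (Monoid.CoprodI fun α : I2 => G α.1))),
        H1h.FG ∧ FactorFreeI H1h ∧ Noncyclic H1h ∧
        rrk H1h = rrk H1 ∧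
        ((∀ α ∈ I1 ∪ I2, Finite (G α)) →
          sSup (wnSetI H1) ≤
            sSup (wnSetD H1h
              (max (I1 ∪ I2).card ((I1 ∪ I2).sup fun α => Nat.card (G α))))) := by
  classical
  obtain ⟨T, hT⟩ := exists_finset_le_range_subFactors h1fg
  obtain ⟨β⟩ : Nonempty I := by
    obtain ⟨u, -, hu⟩ := (Subgroup.bot_or_exists_ne_one H1).resolve_left fun h =>
      h1nc 1 (by rw [h]; exact Subgroup.closure_singleton_one.symm)
    obtain ⟨i, -⟩ := exists_isReducedFrom hu
    exact ⟨i⟩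
  let e : Option (T.erase β) → I := fun α => α.elim β (·.1)
  have he : Function.Injective e := by
    rintro (_ | ⟨a, ha⟩) (_ | ⟨b, hb⟩) h
    · rfl
    · exact absurd h.symm (Finset.ne_of_mem_erase hb)
    · exact absurd h (Finset.ne_of_mem_erase ha)
    · exact congrArg some (Subtype.ext h)
  have hrange : H1 ≤ (subFactors G e).range := by
    refine hT _ e fun i hi => ?_
    by_cases hiβ : i = β
    · exact ⟨none, hiβ.symm⟩
    · exact ⟨some ⟨i, Finset.mem_erase.2 ⟨hiβ, hi⟩⟩, rfl⟩
  have hmem : ∀ α, e α ∈ T.erase β ∪ {β} := by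
    rintro (_ | a)
    · exact Finset.mem_union_right _ (Finset.mem_singleton_self β)
    · exact Finset.mem_union_left _ a.2
  have hdisj : Disjoint (T.erase β) {β} :=
    Finset.disjoint_singleton_right.2 (Finset.notMem_erase β T)
  let P : Option (T.erase β) → Type := fun α => G (e α)
  let _ : ∀ α, Group (P α) := fun α => inferInstanceAs (Group (G (e α)))
  obtain ⟨q₀⟩ := exists_mulEquiv_coprodI_singleton (G := G) β
  let p : CoprodI (fun a => P (some a)) ≃* famTwo (CoprodI fun α : T.erase β => G α.1)
      (CoprodI fun α : ({β} : Finset I) => G α.1) true := MulEquiv.refl _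
  let q : P none ≃* famTwo (CoprodI fun α : T.erase β => G α.1)
      (CoprodI fun α : ({β} : Finset I) => G α.1) false := q₀
  choose x hx using fun α : Option (T.erase β) => exists_ne (1 : G (e α))
  have hg : ∀ a, (fun a => x (some a) : ∀ a, P (some a)) a ≠ 1 := fun a => hx (some a)
  have ht : (x none : P none) ≠ 1 := hx none
  have hφ : Function.Injective (subFactors G e) := subFactors_injective he
  have hψ := twistHom_injective p q hg ht
  let H : Subgroup (CoprodI P) := H1.comap (subFactors G e)
  have hH : H.map (subFactors G e) = H1 := Subgroup.map_comap_eq_self hrange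
  have hfg : H.FG := (fg_map_iff hφ).1 (by rwa [hH])
  have hnc : Noncyclic H := (noncyclic_map_iff hφ).1 (by rwa [hH])
  have hff : FactorFreeI H := by
    have h1 : conjS 1 H1 = H1 := by ext y; simp [mem_conjS]
    have := h1ff.comap_subFactors (e := e) 1
    rwa [h1] at this
  have hrrk : rrk H = rrk H1 := by rw [← hH, rrk, rrk, rk_map hφ]
  refine ⟨T.erase β, {β}, hdisj, H.map (twistHom p q (fun a => x (some a)) (x none)),
    (fg_map_iff hψ).2 hfg, hff.map_twistHom p q hg ht, hnc.map hψ, by rw [← hrrk, rrk, rrk, rk_map hψ], fun hfin => ?_⟩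
  have : ∀ α, Finite (P α) := fun α => hfin _ (hmem α)
  set d := max (T.erase β ∪ {β}).card ((T.erase β ∪ {β}).sup fun α => Nat.card (G α))
  have hP : ∀ α, Nat.card (P α) ≤ d := fun α =>
    le_trans (Finset.le_sup (f := fun α => Nat.card (G α)) (hmem α)) (le_max_right _ _)
  have hd : 2 ≤ d := by
    refine le_trans ?_ (hP none)
    have : Finite (G β) := this none
    exact (Finite.one_lt_card_iff_nontrivial (α := G β)).2 inferInstance
  have hκ : Nat.card (Option (T.erase β)) ≤ d := by
    refine le_trans ?_ (le_max_left _ _)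
    rw [Finset.card_union_of_disjoint hdisj, Finset.card_singleton, Finite.card_option,
      Nat.card_eq_fintype_card, Fintype.card_coe]
  have hb : 0 ≤ sSup (wnSetD (H.map (twistHom p q (fun a => x (some a)) (x none))) d) := by
    refine Real.sSup_nonneg ?_
    rintro _ ⟨K, -, rfl⟩
    positivity
  refine Real.sSup_le ?_ hb
  rintro _ ⟨H2, h2fg, h2ff, h2nc, rfl⟩
  refine div_le_of_le_mul₀ (by positivity) hb ?_
  rw [← hrrk, ← mul_assoc, ← hH]
  exact rrkInter_map_le hφ (cocyclesExtend_subFactors he) h2fg h2ff.isFreeGroup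
    (mul_nonneg hb (Nat.cast_nonneg _)) fun g hKfg J _ s hs =>
      sum_rrk_inf_le_of_map_twistHom p q hg ht hd hκ hP hfg hff hnc hKfg
        (h2ff.comap_subFactors g) s hs
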